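/- arXiv:2405.20276 — 3 statements merged into one kernel-verified Lean document; each statement's English description precedes it below -/
import Mathlib

section
/- Let S be a non-empty countable set. Then every partially exchangeable probability measure on S^ℕ can be written uniquely as a mixture of extreme points of the set 𝒫(S) of partially exchangeable probability measures; that is, for every μ ∈ 𝒫(S) there is a unique probability measure λ on the set ext 𝒫(S) of extreme points of 𝒫(S) such that μ = ∫ ν dλ(ν). In other words, 𝒫(S) is a Choquet simplex. -/
open MeasureTheory Filter Set
open scoped ENNReal

namespace DF

/-! ### Sequences over a countable state space -/

variable {S : Type}

/-- The number of transitions from `u` to `v` among the first `n` steps of the sequence `x`. -/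
noncomputable def transCount (x : ℕ → S) (n : ℕ) (u v : S) : ℕ :=
  Set.ncard {i : ℕ | i < n ∧ x i = u ∧ x (i + 1) = v}

/-- The equivalence `(x₀,…,xₙ) ≃ (y₀,…,yₙ)` of finite sequences: same initial state and the same
transition counts between every ordered pair of states. -/
def FinEquiv (x y : ℕ → S) (n : ℕ) : Prop :=
  x 0 = y 0 ∧ ∀ u v : S, transCount x n u v = transCount y n u v

/-- The equivalence `x ≃ y` of infinite sequences: they eventually agree and their initial
segments up to that point are `≃`-equivalent. -/
def InfEquiv (x y : ℕ → S) : Prop :=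
  ∃ N : ℕ, (∀ n : ℕ, N ≤ n → x n = y n) ∧ FinEquiv x y N

/-- The transition numbers `M(u,v) = #{i ≥ 0 : (xᵢ, xᵢ₊₁) = (u,v)}` of an infinite sequence. -/
noncomputable def transNum (x : ℕ → S) (u v : S) : ℕ∞ :=
  Set.encard {i : ℕ | x i = u ∧ x (i + 1) = v}

/-- The sigma-algebra on `S^ℕ` generated by the transition numbers. -/
noncomputable def transSigma (S : Type) : MeasurableSpace (ℕ → S) :=
  ⨆ u : S, ⨆ v : S, MeasurableSpace.comap (fun x => transNum x u v) (⊤ : MeasurableSpace ℕ∞)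

/-- The tail sigma-algebra `⋂ₙ σ(Xₙ, Xₙ₊₁, …)` on `S^ℕ`. -/
def tailSigma (S : Type) [MeasurableSpace S] : MeasurableSpace (ℕ → S) :=
  ⨅ n : ℕ, MeasurableSpace.comap (fun (x : ℕ → S) (i : ℕ) => x (i + n))
    (inferInstance : MeasurableSpace (ℕ → S))

/-- A measure on `S^ℕ` is partially exchangeable if any two `≃`-equivalent finite initial
segments have the same probability. -/
def PartiallyExchangeable [MeasurableSpace S] (μ : Measure (ℕ → S)) : Prop :=
  ∀ (n : ℕ) (x y : ℕ → S), FinEquiv x y n →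
    μ {ω | ∀ i ≤ n, ω i = x i} = μ {ω | ∀ i ≤ n, ω i = y i}

/-- The set of partially exchangeable probability measures on `S^ℕ`. -/
def PEProb (S : Type) [MeasurableSpace S] : Set (Measure (ℕ → S)) :=
  {μ | μ Set.univ = 1 ∧ PartiallyExchangeable μ}

/-- `μ` is an extreme point of the convex set of partially exchangeable probability measures. -/
def IsExtremePE [MeasurableSpace S] (μ : Measure (ℕ → S)) : Prop :=
  μ ∈ PEProb S ∧
    ∀ μ₁ ∈ PEProb S, ∀ μ₂ ∈ PEProb S, ∀ t : ℝ≥0∞, 0 < t → t < 1 →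
      μ = t • μ₁ + (1 - t) • μ₂ → μ₁ = μ₂

/-! ### Digraphs -/

/-- A digraph on vertex set `V` with edge set `E`: each edge has a tail (`src`) and head (`dst`).
Multiple edges and loops are allowed. -/
structure DigraphStruct (V E : Type) where
  src : E → V
  dst : E → V

namespace DigraphStruct

variable {V E : Type} (G : DigraphStruct V E)

def outEdges (v : V) : Set E := {e | G.src e = v}

def inEdges (v : V) : Set E := {e | G.dst e = v}

noncomputable def outDeg (v : V) : ℕ := (G.outEdges v).ncard

noncomputable def inDeg (v : V) : ℕ := (G.inEdges v).ncard

def LocallyFinite : Prop := ∀ v : V, (G.outEdges v).Finite ∧ (G.inEdges v).Finite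

/-- Adjacency in the underlying undirected graph. -/
def undirAdj (u v : V) : Prop :=
  ∃ e : E, (G.src e = u ∧ G.dst e = v) ∨ (G.src e = v ∧ G.dst e = u)

/-- `G` is connected as an undirected graph. -/
def Connected : Prop := ∀ u v : V, Relation.ReflTransGen G.undirAdj u v

def dirAdj (u v : V) : Prop := ∃ e : E, G.src e = u ∧ G.dst e = v

/-- One step along an edge of the edge set `B`. -/
def step (B : Set E) (u v : V) : Prop := ∃ e ∈ B, G.src e = u ∧ G.dst e = v

/-- `(G,o)` is an infinite sourced Eulerian digraph (with sink at infinity). -/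
structure IsSourcedEulerian (o : V) : Prop where
  infinite : Infinite V
  locFin : G.LocallyFinite
  conn : G.Connected
  balanced : ∀ v : V, v ≠ o → G.inDeg v = G.outDeg v
  source : G.outDeg o = G.inDeg o + 1

/-- The reversal of `G`: head and tail of every edge are exchanged. -/
def rev : DigraphStruct V E := ⟨G.dst, G.src⟩

/-- One-step transition probability of the random walk on `G`. -/
noncomputable def stepProb (u v : V) : ℝ≥0∞ :=
  ({e : E | G.src e = u ∧ G.dst e = v}.ncard : ℝ≥0∞) / (G.outDeg u : ℝ≥0∞)

open Classical in
/-- `μ` is the law of the random walk on `G` started at `o`, characterised through its cylinder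
probabilities. -/
def IsWalkLaw [MeasurableSpace V] (o : V) (μ : Measure (ℕ → V)) : Prop :=
  μ Set.univ = 1 ∧
    ∀ (n : ℕ) (x : ℕ → V),
      μ {ω | ∀ i ≤ n, ω i = x i} =
        if x 0 = o then ∏ i ∈ Finset.range n, G.stepProb (x i) (x (i + 1)) else 0

/-- `G` is transient: from every starting point, the random walk on `G` visits every vertex at
most finitely often almost surely. -/
def TransientDigraph [MeasurableSpace V] : Prop :=
  ∀ (o : V) (μ : Measure (ℕ → V)),
    G.IsWalkLaw o μ → μ {ω | ∀ v : V, {i : ℕ | ω i = v}.Finite} = 1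

/-- An infinite path in `G` indexed by `ℕ`, encoded by its sequence of edges. -/
def IsInfPath (γ : ℕ → E) : Prop := ∀ i : ℕ, G.dst (γ i) = G.src (γ (i + 1))

/-- A transient path: it visits every vertex at most finitely often. -/
def IsTransientPath (γ : ℕ → E) : Prop := ∀ v : V, {i : ℕ | G.src (γ i) = v}.Finite

/-- The edge set of the last-exit arboretum `𝓛(γ)`: the edges crossed by `γ` as it exits their
tail for the last time. -/
def lastExitSet (γ : ℕ → E) : Set E :=
  {e | ∃ i : ℕ, γ i = e ∧ ∀ j : ℕ, i < j → G.src (γ j) ≠ G.src (γ i)}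

end DigraphStruct

/-! ### Finite paths, Eulerian paths, arborescences -/

/-- `IsPathList G o z P` means that the list of edges `P` forms a directed path from `o`
to `z` in `G`. -/
def IsPathList {V E : Type} (G : DigraphStruct V E) : V → V → List E → Prop
  | o, z, [] => o = z
  | o, z, e :: es => G.src e = o ∧ IsPathList G (G.dst e) z es

/-- `P` is an Eulerian path from `o` to `z`: a path crossing every edge exactly once. -/
def IsEulerList {V E : Type} (G : DigraphStruct V E) (o z : V) (P : List E) : Prop :=
  IsPathList G o z P ∧ P.Nodup ∧ ∀ e : E, e ∈ P

/-- `B` is (the edge set of) a spanning in-arborescence of `G` rooted at `z`. -/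
def IsFinArb {V E : Type} (G : DigraphStruct V E) (z : V) (B : Set E) : Prop :=
  (∀ e ∈ B, G.src e ≠ z) ∧
  (∀ v : V, v ≠ z → ∃! e : E, e ∈ B ∧ G.src e = v) ∧
  (∀ v : V, Relation.ReflTransGen (G.step B) v z)

/-- `(G,o,z)` is a finite Eulerian digraph with source `o` and sink `z`. -/
structure IsFinEulerian {V E : Type} (G : DigraphStruct V E) (o z : V) : Prop where
  finV : Finite V
  finE : Finite E
  reach_from : ∀ v : V, Relation.ReflTransGen G.dirAdj o v
  reach_to : ∀ v : V, Relation.ReflTransGen G.dirAdj v z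
  bal_ne : o ≠ z → (∀ v : V, v ≠ o → v ≠ z → G.inDeg v = G.outDeg v) ∧
      G.outDeg o = G.inDeg o + 1 ∧ G.inDeg z = G.outDeg z + 1
  bal_eq : o = z → ∀ v : V, G.inDeg v = G.outDeg v

/-! ### Wired uniform spanning in-arborescences -/

/-- An exhaustion of the vertex set by finite subsets. -/
def IsExhaustion {V : Type} (Vn : ℕ → Set V) : Prop :=
  (∀ n, (Vn n).Finite) ∧ (∀ n, Vn n ⊆ Vn (n + 1)) ∧ (⋃ n, Vn n) = Set.univ

/-- `B` is (the edge set of) a spanning in-arborescence of the wired graph `G_U^*`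
(all vertices outside `U` identified to a single boundary vertex) rooted at the boundary. -/
def IsWiredArb {V E : Type} (G : DigraphStruct V E) (U : Set V) (B : Set E) : Prop :=
  (∀ e ∈ B, G.src e ∈ U) ∧ (∀ v ∈ U, ∃! e : E, e ∈ B ∧ G.src e = v) ∧
  (∀ v ∈ U, ∃ v' : V, v' ∉ U ∧ Relation.ReflTransGen (G.step B) v v')

/-- The probability, under the uniform spanning in-arborescence of the wired graph `G_U^*`
rooted at the boundary, that all edges of `F` are present. -/
noncomputable def wiredUACyl {V E : Type} (G : DigraphStruct V E) (U : Set V) (F : Finset E) :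
    ℝ≥0∞ :=
  (Nat.card {B : Set E // IsWiredArb G U B ∧ (F : Set E) ⊆ B} : ℝ≥0∞) /
    (Nat.card {B : Set E // IsWiredArb G U B} : ℝ≥0∞)

/-- `κ` is the law of the wired uniform spanning in-arboretum of `G` (as a random edge set,
encoded as an element of `E → Bool`): its cylinder probabilities are the limits along any
exhaustion of the uniform spanning in-arborescence measures of the wired graphs. -/
def IsWUALaw {V E : Type} (G : DigraphStruct V E) (κ : Measure (E → Bool)) : Prop :=
  κ Set.univ = 1 ∧
    ∀ Vn : ℕ → Set V, IsExhaustion Vn → ∀ F : Finset E,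
      Filter.Tendsto (fun n => wiredUACyl G (Vn n) F) Filter.atTop
        (nhds (κ {A | ∀ e ∈ F, A e = true}))

/-- A spanning in-arboretum rooted at infinity all of whose components are one-ended:
every vertex has out-degree exactly one, and the past of every vertex is finite. -/
def IsOneEndedSpanningArb {V E : Type} (G : DigraphStruct V E) (A : Set E) : Prop :=
  (∀ v : V, ∃! e : E, e ∈ A ∧ G.src e = v) ∧
    ∀ v : V, {u : V | Relation.ReflTransGen (G.step A) u v}.Finite

/-! ### Proper Gibbs measures on Eulerian paths -/

/-- `w` is a finite path in `G` starting at `o` (encoded by its edges). -/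
def PrefixPath {V E : Type} (G : DigraphStruct V E) (o : V) {n : ℕ} (w : Fin n → E) : Prop :=
  (∀ h : 0 < n, G.src (w ⟨0, h⟩) = o) ∧
    ∀ (i : ℕ) (h : i + 1 < n), G.dst (w ⟨i, Nat.lt_of_succ_lt h⟩) = G.src (w ⟨i + 1, h⟩)

/-- A proper Gibbs measure on Eulerian paths from `o` to `∞` in `G`: a probability measure on
edge sequences, supported on half-infinite paths started at `o` crossing every edge exactly once,
such that conditionally on the steps after time `n` the first `n` steps are a uniform Eulerian
path (from `o`, in the digraph spanned by the edges not crossed after time `n`, to the position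
at time `n`). Uniformity is expressed by invariance under replacing the first `n` steps by any
other path from `o` crossing the same set of edges. -/
def ProperGibbs {V E : Type} [MeasurableSpace E] (G : DigraphStruct V E) (o : V)
    (μ : Measure (ℕ → E)) : Prop :=
  μ Set.univ = 1 ∧
  μ {γ | (∀ i : ℕ, G.dst (γ i) = G.src (γ (i + 1))) ∧ G.src (γ 0) = o ∧ Function.Bijective γ}
      = 1 ∧
  ∀ (n : ℕ) (w w' : Fin n → E), Function.Injective w → Function.Injective w' →
    Set.range w = Set.range w' → PrefixPath G o w → PrefixPath G o w' →
    ∀ B : Set (ℕ → E),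
      μ {γ | (∀ i : Fin n, γ (i : ℕ) = w i) ∧ (fun t : ℕ => γ (n + t)) ∈ B} =
        μ {γ | (∀ i : Fin n, γ (i : ℕ) = w' i) ∧ (fun t : ℕ => γ (n + t)) ∈ B}

/-! ### Loop erasure and Wilson's algorithm rooted at infinity -/

/-- The loop-erasure times of the (transient) vertex sequence `p`:
`t₀ = 0`, `tᵢ₊₁ = 1 + max {t ≥ tᵢ : p t = p tᵢ}`. -/
noncomputable def leTimes {V : Type} (p : ℕ → V) : ℕ → ℕ
  | 0 => 0
  | i + 1 => sSup {t : ℕ | leTimes p i ≤ t ∧ p t = p (leTimes p i)} + 1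

/-- The loop-erasure times of the vertex sequence `p` run up to time `k`. -/
noncomputable def leTimesF {V : Type} (p : ℕ → V) (k : ℕ) : ℕ → ℕ
  | 0 => 0
  | i + 1 => sSup {t : ℕ | leTimesF p k i ≤ t ∧ t ≤ k ∧ p t = p (leTimesF p k i)} + 1

/-- The set of vertices incident to an edge of `A`. -/
def vertsOf {V E : Type} (G : DigraphStruct V E) (A : Set E) : Set V :=
  {u | ∃ e ∈ A, G.src e = u ∨ G.dst e = u}

open Classical in
/-- The set of edges of the loop-erasure of the walk `x` (an edge sequence) stopped when it
first hits `U`; if it never hits `U`, the loop-erasure of the whole (transient) walk. -/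
noncomputable def stoppedLEedges {V E : Type} (G : DigraphStruct V E) (U : Set V) (x : ℕ → E) :
    Set E :=
  if ∃ t : ℕ, G.src (x t) ∈ U then
    {e | ∃ i : ℕ,
      leTimesF (fun t => G.src (x t)) (sInf {t : ℕ | G.src (x t) ∈ U}) i <
          sInf {t : ℕ | G.src (x t) ∈ U} ∧
        x (leTimesF (fun t => G.src (x t)) (sInf {t : ℕ | G.src (x t) ∈ U}) i) = e}
  else Set.range fun i => x (leTimes (fun t => G.src (x t)) i)

/-- The partial edge sets generated by Wilson's algorithm rooted at infinity, run with the
enumeration `v` of the vertices and with `W j` the random walk used at stage `j + 1`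
(started at `v j`). -/
noncomputable def wilsonA {V E : Type} (G : DigraphStruct V E) (v : ℕ → V) (W : ℕ → ℕ → E) :
    ℕ → Set E
  | 0 => ∅
  | j + 1 =>
      wilsonA G v W j ∪
        stoppedLEedges G (vertsOf G (wilsonA G v W j) ∪ {u | ∃ i < j, v i = u}) (W j)

open Classical in
/-- Cylinder probabilities for the random walk on `G` started at `v`, recorded as a sequence of
edges: the probability that the first `n` crossed edges are `x 0, …, x (n-1)`. -/
noncomputable def edgeWalkCyl {V E : Type} (G : DigraphStruct V E) (v : V) (x : ℕ → E) (n : ℕ) :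
    ℝ≥0∞ :=
  if (0 < n → G.src (x 0) = v) ∧ (∀ i : ℕ, i + 1 < n → G.dst (x i) = G.src (x (i + 1))) then
    ∏ i ∈ Finset.range n, ((G.outDeg (G.src (x i)) : ℝ≥0∞))⁻¹
  else 0

/-- `P` is the joint law of a sequence of independent random walks on `G`, the `j`-th walk
started at `v j`. -/
def IsIndepWalksLaw {V E : Type} [MeasurableSpace E] (G : DigraphStruct V E) (v : ℕ → V)
    (P : Measure (ℕ → ℕ → E)) : Prop :=
  P Set.univ = 1 ∧
    ∀ (m n : ℕ) (x : ℕ → ℕ → E),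
      P {ω | ∀ j < m, ∀ t < n, ω j t = x j t} =
        ∏ j ∈ Finset.range m, edgeWalkCyl G (v j) (x j) n

/-- `μ` is the law of the random walk on `G` started at `o`, recorded as its sequence of crossed
edges. -/
def IsEdgeWalkLaw {V E : Type} [MeasurableSpace E] (G : DigraphStruct V E) (o : V)
    (μ : Measure (ℕ → E)) : Prop :=
  μ Set.univ = 1 ∧ ∀ (n : ℕ) (x : ℕ → E), μ {ω | ∀ i < n, ω i = x i} = edgeWalkCyl G o x n

/-! ### Finite approximations and Gibbs measures on arboreta -/

/-- A finite digraph with vertices and edges labelled by natural numbers. -/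
structure FinDigraph where
  VS : Finset ℕ
  ES : Finset ℕ
  fsrc : ℕ → ℕ
  fdst : ℕ → ℕ

/-- `B` is a spanning in-arborescence of the finite digraph `H` rooted at `z`. -/
def FinDigraph.IsArb (H : FinDigraph) (z : ℕ) (B : Finset ℕ) : Prop :=
  B ⊆ H.ES ∧ (∀ e ∈ B, H.fsrc e ≠ z) ∧
  (∀ v ∈ H.VS, v ≠ z → ∃! e : ℕ, e ∈ B ∧ H.fsrc e = v) ∧
  (∀ v ∈ H.VS, Relation.ReflTransGen
      (fun a b => ∃ e ∈ B, H.fsrc e = a ∧ H.fdst e = b) v z)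

/-- A finite digraph `H` with a distinguished vertex `z`, together with a partial isomorphism
to a digraph on `(V, E)`: vertex and edge domains `A`, `F` in `H` and maps `φV`, `φE` to `V`, `E`. -/
structure PIso (V E : Type) where
  H : FinDigraph
  z : ℕ
  A : Finset ℕ
  F : Finset ℕ
  φV : ℕ → V
  φE : ℕ → E

/-- The data of `p` really is a partial isomorphism to `G`. -/
def PIso.Valid {V E : Type} (p : PIso V E) (G : DigraphStruct V E) : Prop :=
  ↑p.A ⊆ ↑p.H.VS ∧ ↑p.F ⊆ ↑p.H.ES ∧ p.z ∈ p.H.VS ∧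
  Set.InjOn p.φV ↑p.A ∧ Set.InjOn p.φE ↑p.F ∧
  ∀ e ∈ p.F, p.H.fsrc e ∈ p.A ∧ p.H.fdst e ∈ p.A ∧
    G.src (p.φE e) = p.φV (p.H.fsrc e) ∧ G.dst (p.φE e) = p.φV (p.H.fdst e)

/-- The partial isomorphism `p` identifies a neighbourhood of (a preimage of) `w`:
`w` is in the range of `φV` and `φE` maps the edges incident to its preimage bijectively onto
the edges incident to `w`. -/
def PIso.GoodAt {V E : Type} (p : PIso V E) (G : DigraphStruct V E) (w : V) : Prop :=
  ∃ w' ∈ p.A, p.φV w' = w ∧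
    (∀ e' ∈ p.H.ES, (p.H.fsrc e' = w' ∨ p.H.fdst e' = w') → e' ∈ p.F) ∧
    ∀ e : E, (G.src e = w ∨ G.dst e = w) →
      ∃! e' : ℕ, e' ∈ p.F ∧ (p.H.fsrc e' = w' ∨ p.H.fdst e' = w') ∧ p.φE e' = e

/-- `a` is a finite approximation to `G`: a sequence of finite digraphs with distinguished
vertices `zₙ` and partial isomorphisms to `G`, identifying larger and larger neighbourhoods of
every finite vertex set, with the distinguished vertices escaping to infinity. -/
def IsFinApproxSeq {V E : Type} (G : DigraphStruct V E) (a : ℕ → PIso V E) : Prop :=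
  (∀ n, (a n).Valid G) ∧
  (∀ W : Finset V, ∃ N, ∀ n ≥ N, ∀ w ∈ W, (a n).GoodAt G w) ∧
  (∀ W : Finset V, ∃ N, ∀ n ≥ N, ¬((a n).z ∈ (a n).A ∧ (a n).φV (a n).z ∈ (W : Set V)))

/-- The probability, under the uniform spanning in-arborescence of `p.H` rooted at `p.z`, that
every edge of `F` is in the image of the arborescence under the partial isomorphism. -/
noncomputable def pisoUACyl {V E : Type} (p : PIso V E) (F : Finset E) :
    ℝ≥0∞ :=
  (Nat.card {B : Finset ℕ // p.H.IsArb p.z B ∧ ∀ e ∈ F, ∃ e' ∈ B, e' ∈ p.F ∧ p.φE e' = e} :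
      ℝ≥0∞) /
    (Nat.card {B : Finset ℕ // p.H.IsArb p.z B} : ℝ≥0∞)

/-- `μ` (a measure on edge sets, encoded as elements of `E → Bool`) is a Gibbs measure on
spanning in-arboreta of `G` rooted at infinity: it is a weak limit of mixtures (over a random
finite approximation to `G`) of uniform spanning in-arborescence measures on finite
approximations to `G`. -/
def IsArbGibbs {V E : Type} (G : DigraphStruct V E) (μ : Measure (E → Bool)) : Prop :=
  μ Set.univ = 1 ∧
  ∃ (Ω : Type) (mΩ : MeasurableSpace Ω) (ν : @Measure Ω mΩ) (a : Ω → ℕ → PIso V E),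
    ν Set.univ = 1 ∧ (∀ ω : Ω, IsFinApproxSeq G (a ω)) ∧
    ∀ F : Finset E,
      Filter.Tendsto (fun n => ∫⁻ ω, pisoUACyl (a ω n) F ∂ν) Filter.atTop
        (nhds (μ {A : E → Bool | ∀ e ∈ F, A e = true}))

/-! ### Stacks -/

open Classical in
/-- The state (current vertex, remaining stacks) after `n` steps of following the stacks `σ`
starting from `o`: at each step we cross the edge at the front of the list at the current vertex
and delete it from the list (doing nothing if the list is empty). -/
noncomputable def stackState {V E : Type} (G : DigraphStruct V E) (o : V) (σ : V → List E) :
    ℕ → V × (V → List E)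
  | 0 => (o, σ)
  | n + 1 =>
    let p := stackState G o σ n
    match p.2 p.1 with
    | [] => p
    | e :: rest => (G.dst e, Function.update p.2 p.1 rest)

/-- The edge crossed at step `n` when following the stacks `σ` from `o` (`none` if the
current stack is exhausted). -/
noncomputable def stackEdge {V E : Type} (G : DigraphStruct V E) (o : V) (σ : V → List E)
    (n : ℕ) : Option E :=
  ((stackState G o σ n).2 (stackState G o σ n).1).head?

/-- The sigma-algebra on stack configurations. -/
noncomputable def stackMS (V E : Type) : MeasurableSpace (V → List E) :=
  @MeasurableSpace.pi V (fun _ => List E) fun _ => ⊤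

open Classical in
/-- `ρ` is the law of the random stack configuration built from a random arboretum with law `κ`:
place the arboretum edge at the bottom of the stack at each vertex, and an independent,
uniformly random ordering of the remaining outgoing edges on top of it. -/
def IsStackLaw {V E : Type} (G : DigraphStruct V E) (κ : Measure (E → Bool))
    (ρ : @Measure (V → List E) (stackMS V E)) : Prop :=
  ρ Set.univ = 1 ∧
    ∀ (K : Finset V) (s : V → List E),
      ρ {σ | ∀ v ∈ K, σ v = s v} =
        if ∀ v ∈ K, (s v).Nodup ∧ ∀ e : E, e ∈ s v ↔ G.src e = v then
          κ {A | ∀ v ∈ K, ∃ e : E, (s v).getLast? = some e ∧ A e = true} *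
            ∏ v ∈ K, (((G.outDeg v - 1).factorial : ℝ≥0∞))⁻¹
        else 0

/-! ### Markov chains -/

open Classical in
/-- `ν` is the law of the trajectory of a Markov chain with state space `S' ⊆ S`, transition
kernel `p` and deterministic initial state `s0`. -/
def IsMCLaw {S : Type} [MeasurableSpace S] (S' : Set S) (p : S → S → ℝ≥0∞) (s0 : S)
    (ν : Measure (ℕ → S)) : Prop :=
  ν Set.univ = 1 ∧ s0 ∈ S' ∧
  (∀ u ∈ S', (∑' v : S, p u v) = 1 ∧ ∀ v : S, p u v ≠ 0 → v ∈ S') ∧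
  (∀ u : S, u ∉ S' → ∀ v : S, p u v = 0) ∧
  ∀ (n : ℕ) (y : ℕ → S),
    ν {x | ∀ i ≤ n, x i = y i} =
      if y 0 = s0 then ∏ i ∈ Finset.range n, p (y i) (y (i + 1)) else 0

/-- `ν` is the law of the trajectory of a recurrent Markov chain on a subset of `S` with
non-random initial state: the chain returns to its initial state infinitely often a.s. -/
def IsRecMCLaw {S : Type} [MeasurableSpace S] (ν : Measure (ℕ → S)) : Prop :=
  ∃ (S' : Set S) (p : S → S → ℝ≥0∞) (s0 : S),
    IsMCLaw S' p s0 ν ∧ ν {x | {i : ℕ | x i = s0}.Infinite} = 1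

/-- `ν` is the law of the sequence of vertices visited by (the unique) proper Gibbs measure on
Eulerian paths from `o` to `∞` on a sourced Eulerian digraph whose vertex set is a subset
of `S`. -/
def IsGibbsVertexLaw {S : Type} [MeasurableSpace S] (ν : Measure (ℕ → S)) : Prop :=
  ∃ (Vs : Set S) (E : Type) (mE : MeasurableSpace E) (G : DigraphStruct (↥Vs) E) (o : ↥Vs),
    Countable E ∧ G.IsSourcedEulerian o ∧
    ∃ μp : @Measure (ℕ → E) (@MeasurableSpace.pi ℕ (fun _ => E) fun _ => mE),
      @ProperGibbs (↥Vs) E mE G o μp ∧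
      ∀ A : Set (ℕ → S), MeasurableSet A →
        ν A = μp ((fun (γ : ℕ → E) (i : ℕ) => ((G.src (γ i) : S))) ⁻¹' A)

/-- Concatenation of a finite list with an infinite sequence. -/
def concatSeq {S : Type} (l : List S) (y : ℕ → S) : ℕ → S :=
  fun i => if h : i < l.length then l.get ⟨i, h⟩ else y (i - l.length)

/-- `ν` is the law of a process following a uniform random Eulerian path on a finite Eulerian
digraph with source and sink whose vertex set is a subset of `S`, followed by the trajectory of
an (independent) recurrent Markov chain on a disjoint subset of `S` with non-random initial
state. -/
def IsMixedLaw {S : Type} [MeasurableSpace S] (ν : Measure (ℕ → S)) : Prop :=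
  ∃ (Vf : Finset S) (Ef : Type) (_ : Finite Ef)
    (Gf : DigraphStruct {s : S // s ∈ Vf} Ef) (of zf : {s : S // s ∈ Vf})
    (Vr : Set S) (p : S → S → ℝ≥0∞) (s1 : S) (νMC : Measure (ℕ → S)),
    IsFinEulerian Gf of zf ∧ Disjoint (↑Vf : Set S) Vr ∧
    IsMCLaw Vr p s1 νMC ∧ νMC {x | {i : ℕ | x i = s1}.Infinite} = 1 ∧
    ∀ A : Set (ℕ → S), MeasurableSet A →
      ν A =
        (∑' L : {L : List Ef // IsEulerList Gf of zf L},
            νMC ((fun y => concatSeq (((of : S)) ::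
              (L : List Ef).map fun e => ((Gf.dst e : S))) y) ⁻¹' A)) /
          (Nat.card {L : List Ef // IsEulerList Gf of zf L} : ℝ≥0∞)

/-! ### L¹ convergence of reverse martingales -/

theorem aesm_iInf {Ω : Type*} {m0 : MeasurableSpace Ω} {μ : Measure Ω}
    (m : ℕ → MeasurableSpace Ω) (hanti : Antitone m) (L : Ω → ℝ)
    (h : ∀ n, AEStronglyMeasurable[m n] L μ) :
    AEStronglyMeasurable[⨅ n, m n] L μ := by
  choose g hg hLg using h
  refine ⟨fun x => limsup (fun n => g n x) atTop, ?_, ?_⟩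
  · apply Measurable.stronglyMeasurable
    intro s hs
    rw [MeasurableSpace.measurableSet_iInf]
    intro k
    have : Measurable[m k] (fun x => limsup (fun n => g (n + k) x) atTop) := by
      apply Measurable.limsup
      intro n
      exact ((hg (n + k)).measurable).mono (hanti (Nat.le_add_left k n)) le_rfl
    have h2 : (fun x => limsup (fun n => g n x) atTop)
        = (fun x => limsup (fun n => g (n + k) x) atTop) := by
      funext x
      exact (limsup_nat_add (fun n => g n x) k).symm
    rw [h2]
    exact this hs
  · filter_upwards [ae_all_iff.2 hLg] with x hx
    have : (fun n => g n x) = fun _ => L x := by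
      funext n; exact (hx n).symm
    rw [this, limsup_const]

theorem tendsto_condExp_iInf {Ω : Type*} {m0 : MeasurableSpace Ω} {μ : Measure Ω}
    [IsProbabilityMeasure μ]
    (m : ℕ → MeasurableSpace Ω) (hanti : Antitone m) (hm : ∀ n, m n ≤ m0)
    (f : Ω → ℝ) (hf : MemLp f 2 μ) :
    Tendsto (fun n => ∫⁻ x, ‖(μ[f | m n]) x - (μ[f | ⨅ k, m k]) x‖ₑ ∂μ) atTop (nhds 0) := by
  have : ∀ n, Fact (m n ≤ m0) := fun n => ⟨hm n⟩
  have hmI : (⨅ k, m k) ≤ m0 := (iInf_le m 0).trans (hm 0)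
  let K : ℕ → Submodule ℝ (Lp ℝ 2 μ) := fun n => lpMeas ℝ ℝ (m n) 2 μ
  have hKc : ∀ n, IsClosed (K n : Set (Lp ℝ 2 μ)) := fun n =>
    isClosed_aestronglyMeasurable (F := ℝ) (p := 2) (hm n)
  have : ∀ n, CompleteSpace (K n) := fun n => (hKc n).completeSpace_coe
  have hKanti : Antitone K := by
    intro i j hij g hg
    have := mem_lpMeas_iff_aestronglyMeasurable.1 hg
    exact mem_lpMeas_iff_aestronglyMeasurable.2 (this.mono (hanti hij))
  let F : Lp ℝ 2 μ := hf.toLp f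
  have hconv : ∃ L : Lp ℝ 2 μ, Tendsto (fun n => (K n).starProjection F) atTop (nhds L) := by
    have hU : Monotone (fun n => (K n)ᗮ) := fun i j hij =>
      Submodule.orthogonal_le (hKanti hij)
    have := Submodule.starProjection_tendsto_closure_iSup (fun n => (K n)ᗮ) hU F
    refine ⟨_, (tendsto_const_nhds (x := F)).sub this |>.congr ?_⟩
    intro n
    simp [Submodule.starProjection_orthogonal]
  obtain ⟨L, hL⟩ := hconv
  have hLK : ∀ n, L ∈ K n := by
    intro n
    refine (hKc n).mem_of_tendsto hL ?_
    filter_upwards [eventually_ge_atTop n] with k hk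
    exact hKanti hk (Submodule.starProjection_apply_mem _ _)
  have hce : ∀ n, (((K n).starProjection F : Lp ℝ 2 μ) : Ω → ℝ) =ᵐ[μ] μ[f | m n] := by
    intro n
    exact hf.condExpL2_ae_eq_condExp (hm n)
  have hfint : Integrable f μ := hf.integrable (by norm_num)
  have hLint : Integrable L μ := (Lp.memLp L).integrable (by norm_num)
  -- L1 convergence
  have hL1 : Tendsto (fun n => ∫⁻ x, ‖(μ[f | m n]) x - L x‖ₑ ∂μ) atTop (nhds 0) := by
    have h1 : Tendsto (fun n => edist ((K n).starProjection F) L) atTop (nhds 0) :=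
      tendsto_iff_edist_tendsto_0.1 hL
    refine tendsto_of_tendsto_of_tendsto_of_le_of_le tendsto_const_nhds h1
      (fun _ => by positivity) ?_
    intro n
    simp only
    rw [Lp.edist_def]
    have hae : (fun x => (μ[f | m n]) x - L x) =ᵐ[μ]
        ((((K n).starProjection F : Lp ℝ 2 μ) : Ω → ℝ) - (L : Ω → ℝ)) := by
      filter_upwards [hce n] with x hx
      simp [hx]
    rw [← eLpNorm_congr_ae hae, ← eLpNorm_one_eq_lintegral_enorm]
    refine eLpNorm_le_eLpNorm_of_exponent_le (by norm_num) ?_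
    exact (integrable_condExp.sub hLint).aestronglyMeasurable
  have hLeq : (L : Ω → ℝ) =ᵐ[μ] μ[f | ⨅ k, m k] := by
    refine ae_eq_condExp_of_forall_setIntegral_eq hmI hfint
      (fun s _ _ => hLint.integrableOn) ?_ ?_
    · intro s hs _
      have hsm : ∀ n, MeasurableSet[m n] s := MeasurableSpace.measurableSet_iInf.1 hs
      have h2 : Tendsto (fun n => ∫ x in s, (μ[f | m n]) x ∂μ) atTop
          (nhds (∫ x in s, L x ∂μ)) := by
        refine tendsto_setIntegral_of_L1 _ hLint.aestronglyMeasurable ?_ hL1 s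
        exact Eventually.of_forall fun n => integrable_condExp
      have h3 : (fun n => ∫ x in s, (μ[f | m n]) x ∂μ) = fun _ => ∫ x in s, f x ∂μ := by
        funext n
        exact setIntegral_condExp (hm n) hfint (hsm n)
      rw [h3] at h2
      exact tendsto_nhds_unique h2 tendsto_const_nhds |>.symm ▸ rfl
    · exact aesm_iInf m hanti _ fun n => mem_lpMeas_iff_aestronglyMeasurable.1 (hLK n)
  refine hL1.congr fun n => ?_
  refine lintegral_congr_ae ?_
  filter_upwards [hLeq] with x hx
  rw [hx]

/-! ### Combinatorics of the equivalence relation -/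

/-- The multiset of transitions. -/
def pairsMS (x : ℕ → S) (n : ℕ) : Multiset (S × S) :=
  (Multiset.range n).map fun i => (x i, x (i + 1))

open Classical in
theorem count_pairsMS (x : ℕ → S) (n : ℕ) (u v : S) :
    (pairsMS x n).count (u, v) = transCount x n u v := by
  unfold pairsMS transCount
  rw [Multiset.count_map]
  have : {i : ℕ | i < n ∧ x i = u ∧ x (i + 1) = v}
      = ((Finset.range n).filter fun i => (u, v) = (x i, x (i + 1)) : Finset ℕ) := by
    ext i
    simp only [Set.mem_ofPred_eq, Finset.coe_filter, Finset.mem_range, Prod.mk.injEq]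
    constructor
    · rintro ⟨h1, h2, h3⟩; exact ⟨h1, h2.symm, h3.symm⟩
    · rintro ⟨h1, h2, h3⟩; exact ⟨h1, h2.symm, h3.symm⟩
  rw [this, Set.ncard_coe_finset]
  rfl

theorem finEquiv_iff (x y : ℕ → S) (n : ℕ) :
    FinEquiv x y n ↔ x 0 = y 0 ∧ pairsMS x n = pairsMS y n := by
  classical
  unfold FinEquiv
  refine and_congr_right fun _ => ?_
  constructor
  · intro h
    ext ⟨u, v⟩
    rw [count_pairsMS, count_pairsMS, h]
  · intro h u v
    rw [← count_pairsMS, ← count_pairsMS, h]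

theorem pairsMS_succ (x : ℕ → S) (n : ℕ) :
    pairsMS x (n + 1) = (x n, x (n + 1)) ::ₘ pairsMS x n := by
  simp [pairsMS, Multiset.range_succ]

theorem pairsMS_congr {x y : ℕ → S} {n : ℕ} (h : ∀ i ≤ n, x i = y i) :
    pairsMS x n = pairsMS y n := by
  unfold pairsMS
  refine Multiset.map_congr rfl fun i hi => ?_
  rw [Multiset.mem_range] at hi
  rw [h i hi.le, h (i + 1) hi]

theorem pairsMS_fst_snd (x : ℕ → S) (n : ℕ) :
    x 0 ::ₘ (pairsMS x n).map Prod.snd = x n ::ₘ (pairsMS x n).map Prod.fst := by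
  induction n with
  | zero => simp [pairsMS]
  | succ n ih =>
    rw [pairsMS_succ, Multiset.map_cons, Multiset.map_cons, Multiset.cons_swap, ih]

theorem FinEquiv.last {x y : ℕ → S} {n : ℕ} (h : FinEquiv x y n) : x n = y n := by
  rw [finEquiv_iff] at h
  have h1 := pairsMS_fst_snd x n
  have h2 := pairsMS_fst_snd y n
  rw [h.1, h.2, h2] at h1
  exact ((Multiset.cons_inj_left _).1 h1).symm

theorem FinEquiv.refl (x : ℕ → S) (n : ℕ) : FinEquiv x x n := ⟨rfl, fun _ _ => rfl⟩

theorem FinEquiv.symm {x y : ℕ → S} {n : ℕ} (h : FinEquiv x y n) : FinEquiv y x n :=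
  ⟨h.1.symm, fun u v => (h.2 u v).symm⟩

theorem FinEquiv.trans {x y z : ℕ → S} {n : ℕ} (h : FinEquiv x y n) (h' : FinEquiv y z n) :
    FinEquiv x z n :=
  ⟨h.1.trans h'.1, fun u v => (h.2 u v).trans (h'.2 u v)⟩

theorem FinEquiv.of_eq {x y : ℕ → S} {n : ℕ} (h : ∀ i ≤ n, x i = y i) : FinEquiv x y n :=
  (finEquiv_iff _ _ _).2 ⟨h 0 (Nat.zero_le _), pairsMS_congr h⟩

theorem FinEquiv.mono {x y : ℕ → S} {n m : ℕ} (h : FinEquiv x y n) (hnm : n ≤ m)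
    (htail : ∀ i, n ≤ i → x i = y i) : FinEquiv x y m := by
  induction m, hnm using Nat.le_induction with
  | base => exact h
  | succ m hm ih =>
    rw [finEquiv_iff] at ih ⊢
    refine ⟨ih.1, ?_⟩
    rw [pairsMS_succ, pairsMS_succ, ih.2, htail m hm, htail (m + 1) (by omega)]

/-- Every letter of an equivalent word occurs in the word. -/
theorem FinEquiv.mem {x y : ℕ → S} {n : ℕ} (h : FinEquiv x y n) (i : ℕ) (hi : i ≤ n) :
    ∃ j ≤ n, y i = x j := by
  rcases Nat.eq_zero_or_pos i with rfl | hpos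
  · exact ⟨0, Nat.zero_le _, h.1.symm⟩
  · obtain ⟨k, rfl⟩ : ∃ k, i = k + 1 := ⟨i - 1, by omega⟩
    rw [finEquiv_iff] at h
    have hm : (y k, y (k + 1)) ∈ pairsMS y n := by
      unfold pairsMS
      exact Multiset.mem_map.2 ⟨k, Multiset.mem_range.2 hi, rfl⟩
    rw [← h.2] at hm
    obtain ⟨j, hj, hjk⟩ := Multiset.mem_map.1 hm
    rw [Multiset.mem_range] at hj
    exact ⟨j + 1, hj, (Prod.mk.inj hjk).2.symm⟩

/-- The cylinder set determined by the first `n + 1` coordinates of `x`. -/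
def cyl (n : ℕ) (x : ℕ → S) : Set (ℕ → S) := {ω | ∀ i ≤ n, ω i = x i}

/-- Replace the first `n + 1` coordinates of `z` by those of `x`. -/
def splice (n : ℕ) (x z : ℕ → S) : ℕ → S := fun i => if i ≤ n then x i else z i

/-- The prefix of `x`. -/
def pre (n : ℕ) (x : ℕ → S) : Fin (n + 1) → S := fun i => x i

/-- Extend a word to a sequence. -/
def ext (n : ℕ) (w : Fin (n + 1) → S) : ℕ → S := fun i => w ⟨min i n, by omega⟩

theorem pre_ext (n : ℕ) (w : Fin (n + 1) → S) : pre n (ext n w) = w := by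
  funext i
  unfold pre ext
  congr 1
  ext
  simp; omega

theorem ext_pre_apply (n : ℕ) (x : ℕ → S) (i : ℕ) (hi : i ≤ n) : ext n (pre n x) i = x i := by
  simp [pre, ext, hi]

theorem pre_eq_iff (n : ℕ) (x y : ℕ → S) : pre n x = pre n y ↔ ∀ i ≤ n, x i = y i := by
  constructor
  · intro h i hi
    exact congrFun h ⟨i, by omega⟩
  · intro h
    funext i
    exact h i (by omega)

theorem pre_preimage (n : ℕ) (w : Fin (n + 1) → S) : pre n ⁻¹' {w} = cyl n (ext n w) := by
  ext x
  rw [Set.mem_preimage, Set.mem_singleton_iff]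
  conv_lhs => rw [← pre_ext n w]
  exact pre_eq_iff n x _

/-- Equivalence of words. -/
def WEquiv (n : ℕ) (w w' : Fin (n + 1) → S) : Prop := FinEquiv (ext n w) (ext n w') n

theorem wEquiv_pre (n : ℕ) (x y : ℕ → S) : WEquiv n (pre n x) (pre n y) ↔ FinEquiv x y n := by
  have h : ∀ z : ℕ → S, FinEquiv (ext n (pre n z)) z n := fun z =>
    FinEquiv.of_eq (ext_pre_apply n z)
  exact ⟨fun H => ((h x).symm.trans H).trans (h y), fun H => ((h x).trans H).trans (h y).symm⟩

theorem finite_class (n : ℕ) (w : Fin (n + 1) → S) : {w' | WEquiv n w w'}.Finite := by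
  have hf : (Set.pi Set.univ fun _ : Fin (n + 1) => Set.range w).Finite :=
    Set.Finite.pi fun _ => Set.finite_range w
  refine hf.subset ?_
  intro w' hw' i _
  obtain ⟨j, hj, hij⟩ := FinEquiv.mem hw' i (by omega)
  refine ⟨⟨j, by omega⟩, ?_⟩
  have h1 : ext n w' i = w' i := by
    have := congrFun (pre_ext n w') i
    exact this
  have h2 : ext n w j = w ⟨j, by omega⟩ := by
    have := congrFun (pre_ext n w) ⟨j, by omega⟩
    exact this
  rw [← h2, ← hij, h1]

open Classical in
/-- The averaging kernel over equivalence classes. -/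
noncomputable def avgK (n : ℕ) (w w' : Fin (n + 1) → S) : ℝ≥0∞ :=
  if WEquiv n w w' then ((({v | WEquiv n w v} : Set (Fin (n + 1) → S)).encard : ℕ∞) : ℝ≥0∞)⁻¹
  else 0

theorem WEquiv.class_eq {n : ℕ} {w w' : Fin (n + 1) → S} (h : WEquiv n w w') :
    {v | WEquiv n w v} = {v | WEquiv n w' v} := by
  ext v
  exact ⟨fun H => h.symm.trans H, fun H => h.trans H⟩

theorem avgK_symm (n : ℕ) (w w' : Fin (n + 1) → S) : avgK n w w' = avgK n w' w := by
  unfold avgK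
  by_cases h : WEquiv n w w'
  · have h' : WEquiv n w' w := h.symm
    rw [if_pos h, if_pos h', h.class_eq]
  · have h' : ¬ WEquiv n w' w := fun H => h (FinEquiv.symm H)
    rw [if_neg h, if_neg h']

theorem tsum_avgK (n : ℕ) (w : Fin (n + 1) → S) : ∑' w', avgK n w w' = 1 := by
  classical
  have h1 : ∀ w', avgK n w w' = Set.indicator {v | WEquiv n w v}
      (fun _ => ((({v | WEquiv n w v} : Set (Fin (n + 1) → S)).encard : ℕ∞) : ℝ≥0∞)⁻¹) w' := by
    intro w'
    simp [avgK, Set.indicator]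
  simp_rw [h1]
  rw [← tsum_subtype, ENNReal.tsum_const, ENat.card_coe_set_eq]
  refine ENNReal.mul_inv_cancel ?_ ?_
  · have : w ∈ {v | WEquiv n w v} := FinEquiv.refl _ _
    simp only [ne_eq, ENat.toENNReal_eq_zero, Set.encard_eq_zero]
    exact Set.Nonempty.ne_empty ⟨w, this⟩
  · simpa using finite_class n w

/-! ### Measure theory on sequence space -/

set_option linter.unusedSectionVars false

section Meas

variable [Countable S] [MeasurableSpace S] [DiscreteMeasurableSpace S]

theorem measurable_pre (n : ℕ) : Measurable (pre n : (ℕ → S) → Fin (n + 1) → S) :=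
  measurable_pi_lambda _ fun _ => measurable_pi_apply _

theorem measurableSet_cyl (n : ℕ) (x : ℕ → S) : MeasurableSet (cyl n x) := by
  have : cyl n x = ⋂ i, ⋂ (_ : i ≤ n), (fun ω : ℕ → S => ω i) ⁻¹' {x i} := by
    ext ω; simp [cyl]
  rw [this]
  exact MeasurableSet.iInter fun i => MeasurableSet.iInter fun _ =>
    measurable_pi_apply i (measurableSet_singleton _)

theorem measurable_splice (n : ℕ) (x : ℕ → S) : Measurable (splice n x) := by
  refine measurable_pi_lambda _ fun i => ?_
  unfold splice
  by_cases h : i ≤ n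
  · simp [h]
  · simp only [h, if_false]
    exact measurable_pi_apply i

/-- Decompose a measure along prefixes. -/
theorem measure_eq_tsum_pre (ν : Measure (ℕ → S)) (n : ℕ) (A : Set (ℕ → S))
    (hA : MeasurableSet A) :
    ν A = ∑' w : Fin (n + 1) → S, ν (A ∩ cyl n (ext n w)) := by
  rw [← measure_iUnion]
  · congr 1
    ext x
    simp only [← pre_preimage, Set.mem_iUnion, Set.mem_inter_iff, Set.mem_preimage,
      Set.mem_singleton_iff]
    simp
  · intro w w' hww'
    simp only [Function.onFun, ← pre_preimage]
    rw [Set.disjoint_left]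
    rintro x ⟨_, h1⟩ ⟨_, h2⟩
    exact hww' (h1.symm.trans h2)
  · intro w
    exact hA.inter (measurableSet_cyl _ _)

theorem lintegral_pre (ν : Measure (ℕ → S)) (n : ℕ) (A : Set (ℕ → S))
    (F : (Fin (n + 1) → S) → ℝ≥0∞) :
    ∫⁻ x in A, F (pre n x) ∂ν = ∑' w, F w * ν (A ∩ cyl n (ext n w)) := by
  have hF : Measurable F := measurable_of_countable F
  rw [← lintegral_map hF (measurable_pre n), lintegral_countable']
  congr 1
  funext w
  rw [Measure.map_apply (measurable_pre n) (measurableSet_singleton _), pre_preimage,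
    Measure.restrict_apply (measurableSet_cyl _ _), Set.inter_comm]

theorem cyl_measure_ext (μ ν : Measure (ℕ → S)) [IsFiniteMeasure μ] (N : ℕ)
    (h : ∀ m, N ≤ m → ∀ c, μ (cyl m c) = ν (cyl m c)) : μ = ν := by
  have hgen : (inferInstance : MeasurableSpace (ℕ → S))
      = MeasurableSpace.generateFrom {A | ∃ m, N ≤ m ∧ ∃ c, A = cyl m c} := by
    apply le_antisymm
    · refine iSup_le fun i => ?_
      rintro _ ⟨s, _, rfl⟩
      have : (fun ω : ℕ → S => ω i) ⁻¹' s
          = ⋃ w : {w : Fin (max i N + 1) → S // w ⟨i, by omega⟩ ∈ s},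
              cyl (max i N) (ext (max i N) w.1) := by
        ext x
        simp only [← pre_preimage, Set.mem_iUnion, Set.mem_preimage, Set.mem_singleton_iff]
        constructor
        · intro hx
          exact ⟨⟨pre _ x, hx⟩, rfl⟩
        · rintro ⟨⟨w, hw⟩, rfl⟩
          exact hw
      rw [this]
      refine MeasurableSet.iUnion fun w => ?_
      exact MeasurableSpace.measurableSet_generateFrom ⟨_, le_max_right _ _, _, rfl⟩
    · refine MeasurableSpace.generateFrom_le ?_
      rintro _ ⟨m, _, c, rfl⟩
      exact measurableSet_cyl m c
  refine ext_of_generate_finite _ hgen ?_ ?_ ?_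
  · rintro _ ⟨m, hm, c, rfl⟩ _ ⟨m', hm', c', rfl⟩ ⟨z, hz, hz'⟩
    refine ⟨max m m', hm.trans (le_max_left _ _), z, ?_⟩
    ext ω
    constructor
    · rintro ⟨h1, h2⟩ i hi
      rcases le_max_iff.1 hi with hi | hi
      · rw [h1 i hi, hz i hi]
      · rw [h2 i hi, hz' i hi]
    · intro hω
      refine ⟨fun i hi => ?_, fun i hi => ?_⟩
      · rw [hω i (hi.trans (le_max_left _ _)), hz i hi]
      · rw [hω i (hi.trans (le_max_right _ _)), hz' i hi]
  · rintro _ ⟨m, hm, c, rfl⟩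
    exact h m hm c
  · rw [measure_eq_tsum_pre μ N _ MeasurableSet.univ, measure_eq_tsum_pre ν N _ MeasurableSet.univ]
    congr 1
    funext w
    rw [Set.univ_inter, h N le_rfl]

/-- Sets invariant under equivalent changes of the first `n + 1` coordinates. -/
def invSigma (S : Type) [MeasurableSpace S] (n : ℕ) : MeasurableSpace (ℕ → S) where
  MeasurableSet' A := MeasurableSet A ∧
    ∀ x y : ℕ → S, FinEquiv x y n → (∀ i, n ≤ i → x i = y i) → (x ∈ A ↔ y ∈ A)
  measurableSet_empty := ⟨MeasurableSet.empty, fun _ _ _ _ => Iff.rfl⟩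
  measurableSet_compl A hA := ⟨hA.1.compl, fun x y h h' => not_congr (hA.2 x y h h')⟩
  measurableSet_iUnion f hf := ⟨MeasurableSet.iUnion fun i => (hf i).1, fun x y h h' => by
    simp only [Set.mem_iUnion]
    exact exists_congr fun i => (hf i).2 x y h h'⟩

theorem invSigma_le (n : ℕ) : invSigma S n ≤ (inferInstance : MeasurableSpace (ℕ → S)) :=
  fun _ hA => hA.1

theorem invSigma_anti : Antitone (invSigma S) := by
  intro n m hnm A hA
  refine ⟨hA.1, fun x y h h' => hA.2 x y (h.mono hnm h') fun i hi => h' i (hnm.trans hi)⟩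

/-- The exchangeable sigma-algebra. -/
def exSigma (S : Type) [MeasurableSpace S] : MeasurableSpace (ℕ → S) := ⨅ n, invSigma S n

theorem exSigma_le : exSigma S ≤ (inferInstance : MeasurableSpace (ℕ → S)) :=
  (iInf_le _ 0).trans (invSigma_le 0)

theorem exSigma_le_inv (n : ℕ) : exSigma S ≤ invSigma S n := iInf_le _ n

theorem PEProb.isProb {ν : Measure (ℕ → S)} (h : ν ∈ PEProb S) : IsProbabilityMeasure ν :=
  ⟨h.1⟩

theorem pe_inv {ν : Measure (ℕ → S)} (h : ν ∈ PEProb S) {n : ℕ} {x y : ℕ → S}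
    (hxy : FinEquiv x y n) {A : Set (ℕ → S)} (hA : MeasurableSet[invSigma S n] A) :
    ν (A ∩ cyl n x) = ν (A ∩ cyl n y) := by
  have := PEProb.isProb h
  have key : (ν.restrict (cyl n x)).map (splice n y) = ν.restrict (cyl n y) := by
    refine cyl_measure_ext _ _ n fun m hm c => ?_
    rw [Measure.map_apply (measurable_splice n y) (measurableSet_cyl _ _),
      Measure.restrict_apply (measurable_splice n y (measurableSet_cyl _ _)),
      Measure.restrict_apply (measurableSet_cyl _ _)]
    by_cases hc : ∀ i ≤ n, c i = y i
    · have e1 : cyl m c ∩ cyl n y = cyl m (splice n y c) := by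
        ext ω
        constructor
        · rintro ⟨h1, h2⟩ i hi
          unfold splice
          split_ifs with hin
          · exact h2 i hin
          · exact h1 i hi
        · intro hω
          refine ⟨fun i hi => ?_, fun i hi => ?_⟩
          · rw [hω i hi]
            unfold splice
            split_ifs with hin
            · exact (hc i hin).symm
            · rfl
          · rw [hω i (hi.trans hm)]
            simp [splice, hi]
      have e2 : splice n y ⁻¹' cyl m c ∩ cyl n x = cyl m (splice n x c) := by
        ext ω
        constructor
        · rintro ⟨h1, h2⟩ i hi
          have := h1 i hi
          unfold splice at this ⊢
          split_ifs at this ⊢ with hin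
          · exact h2 i hin
          · exact this
        · intro hω
          refine ⟨fun i hi => ?_, fun i hi => ?_⟩
          · have := hω i hi
            unfold splice at this ⊢
            split_ifs at this ⊢ with hin
            · exact (hc i hin).symm
            · exact this
          · rw [hω i (hi.trans hm)]
            simp [splice, hi]
      rw [e1, e2]
      refine h.2 m _ _ (FinEquiv.mono (n := n) ?_ hm ?_)
      · have hx : FinEquiv (splice n x c) x n := FinEquiv.of_eq fun i hi => by simp [splice, hi]
        have hy : FinEquiv (splice n y c) y n := FinEquiv.of_eq fun i hi => by simp [splice, hi]
        exact (hx.trans hxy).trans hy.symm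
      · intro i hi
        unfold splice
        split_ifs with hin
        · have : i = n := le_antisymm hin hi
          rw [this]; exact hxy.last
        · rfl
    · push Not at hc
      obtain ⟨i, hi, hci⟩ := hc
      have e1 : cyl m c ∩ cyl n y = ∅ := by
        rw [Set.eq_empty_iff_forall_notMem]
        rintro ω ⟨h1, h2⟩
        exact hci ((h1 i (hi.trans hm)).symm.trans (h2 i hi))
      have e2 : splice n y ⁻¹' cyl m c ∩ cyl n x = ∅ := by
        rw [Set.eq_empty_iff_forall_notMem]
        rintro ω ⟨h1, _⟩
        have := h1 i (hi.trans hm)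
        simp only [splice, hi, if_true] at this
        exact hci this.symm
      rw [e1, e2]
  have hmA : MeasurableSet A := hA.1
  have h1 : (ν.restrict (cyl n x)).map (splice n y) A = ν.restrict (cyl n y) A := by rw [key]
  rw [Measure.map_apply (measurable_splice n y) hmA,
    Measure.restrict_apply (measurable_splice n y hmA), Measure.restrict_apply hmA] at h1
  rw [← h1]
  congr 1
  ext ω
  refine and_congr_left fun hω => ?_
  refine hA.2 _ _ ?_ ?_
  · have hx : FinEquiv ω x n := FinEquiv.of_eq hω
    have hy : FinEquiv (splice n y ω) y n := FinEquiv.of_eq fun i hi => by simp [splice, hi]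
    exact (hx.trans hxy).trans hy.symm
  · intro i hi
    unfold splice
    split_ifs with hin
    · have : i = n := le_antisymm hin hi
      subst this
      rw [hω i le_rfl]
      exact hxy.last
    · rfl

open Classical in
/-- The average of the indicator of a cylinder set over equivalence classes of words. -/
noncomputable def qE (m : ℕ) (c : ℕ → S) (n : ℕ) (w : Fin (n + 1) → S) : ℝ≥0∞ :=
  ∑' w', avgK n w w' * (if ext n w' ∈ cyl m c then 1 else 0)

theorem qE_le_one (m : ℕ) (c : ℕ → S) (n : ℕ) (w : Fin (n + 1) → S) : qE m c n w ≤ 1 := by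
  rw [← tsum_avgK n w]
  refine ENNReal.tsum_le_tsum fun w' => ?_
  split_ifs <;> simp

theorem setLIntegral_qE {ν : Measure (ℕ → S)} (h : ν ∈ PEProb S) {m n : ℕ} (hmn : m ≤ n)
    (c : ℕ → S) {A : Set (ℕ → S)} (hA : MeasurableSet[invSigma S n] A) :
    ∫⁻ x in A, qE m c n (pre n x) ∂ν = ν (A ∩ cyl m c) := by
  classical
  rw [lintegral_pre, measure_eq_tsum_pre ν n _ (hA.1.inter (measurableSet_cyl _ _))]
  have h1 : ∀ w, qE m c n w * ν (A ∩ cyl n (ext n w))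
      = ∑' w', avgK n w' w * ((if ext n w' ∈ cyl m c then 1 else 0)
          * ν (A ∩ cyl n (ext n w'))) := by
    intro w
    rw [qE, ← ENNReal.tsum_mul_right]
    congr 1
    funext w'
    rw [avgK_symm, mul_assoc]
    by_cases hw : WEquiv n w' w
    · rw [pe_inv h hw hA]
    · simp [avgK, hw]
  simp_rw [h1]
  rw [ENNReal.tsum_comm]
  congr 1
  funext w'
  rw [ENNReal.tsum_mul_right, tsum_avgK, one_mul]
  have hcw : ∀ x ∈ cyl n (ext n w'), (x ∈ cyl m c ↔ ext n w' ∈ cyl m c) := by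
    intro x hx
    refine forall_congr' fun i => forall_congr' fun hi => ?_
    rw [hx i (hi.trans hmn)]
  split_ifs with hw
  · rw [one_mul]
    congr 1
    ext x
    constructor
    · rintro ⟨h1, h2⟩; exact ⟨⟨h1, (hcw x h2).2 hw⟩, h2⟩
    · rintro ⟨⟨h1, _⟩, h2⟩; exact ⟨h1, h2⟩
  · rw [zero_mul]
    symm
    convert measure_empty (μ := ν)
    rw [Set.eq_empty_iff_forall_notMem]
    rintro x ⟨⟨_, h1⟩, h2⟩
    exact hw ((hcw x h2).1 h1)

/-- Real version of the averages. -/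
noncomputable def qR (m : ℕ) (c : ℕ → S) (n : ℕ) (x : ℕ → S) : ℝ := (qE m c n (pre n x)).toReal

theorem measurable_qR_inv (m : ℕ) (c : ℕ → S) (n : ℕ) : Measurable[invSigma S n] (qR m c n) := by
  have hm : Measurable (qR m c n) :=
    ((measurable_of_countable (qE m c n)).comp (measurable_pre n)).ennreal_toReal
  intro s hs
  refine ⟨hm hs, fun x y hxy _ => ?_⟩
  have : qR m c n x = qR m c n y := by
    have hw : WEquiv n (pre n x) (pre n y) := (wEquiv_pre n x y).2 hxy
    have hK : ∀ w', avgK n (pre n x) w' = avgK n (pre n y) w' := by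
      intro w'
      have hiff : WEquiv n (pre n x) w' ↔ WEquiv n (pre n y) w' :=
        ⟨fun H => FinEquiv.trans hw.symm H, fun H => FinEquiv.trans hw H⟩
      unfold avgK
      rw [hw.class_eq]
      by_cases hh : WEquiv n (pre n x) w'
      · rw [if_pos hh, if_pos (hiff.1 hh)]
      · rw [if_neg hh, if_neg fun H => hh (hiff.2 H)]
    unfold qR qE
    simp_rw [hK]
  simp only [Set.mem_preimage, this]

theorem measurable_qR (m : ℕ) (c : ℕ → S) (n : ℕ) : Measurable (qR m c n) :=
  (measurable_qR_inv m c n).mono (invSigma_le n) le_rfl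

theorem ofReal_qR (m : ℕ) (c : ℕ → S) (n : ℕ) (x : ℕ → S) :
    ENNReal.ofReal (qR m c n x) = qE m c n (pre n x) :=
  ENNReal.ofReal_toReal (ne_top_of_le_ne_top ENNReal.one_ne_top (qE_le_one _ _ _ _))

theorem qR_nonneg (m : ℕ) (c : ℕ → S) (n : ℕ) (x : ℕ → S) : 0 ≤ qR m c n x :=
  ENNReal.toReal_nonneg

theorem qR_le_one (m : ℕ) (c : ℕ → S) (n : ℕ) (x : ℕ → S) : qR m c n x ≤ 1 :=
  ENNReal.toReal_le_of_le_ofReal zero_le_one (by simpa using qE_le_one m c n (pre n x))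

theorem integrable_qR (ν : Measure (ℕ → S)) [IsFiniteMeasure ν] (m : ℕ) (c : ℕ → S) (n : ℕ) :
    Integrable (qR m c n) ν := by
  refine Integrable.of_bound (measurable_qR m c n).aestronglyMeasurable 1 ?_
  refine Eventually.of_forall fun x => ?_
  rw [Real.norm_of_nonneg (qR_nonneg _ _ _ _)]
  exact qR_le_one _ _ _ _

theorem setIntegral_qR {ν : Measure (ℕ → S)} (h : ν ∈ PEProb S) {m n : ℕ} (hmn : m ≤ n)
    (c : ℕ → S) {A : Set (ℕ → S)} (hA : MeasurableSet[invSigma S n] A) :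
    ∫ x in A, qR m c n x ∂ν = ν.real (A ∩ cyl m c) := by
  rw [integral_eq_lintegral_of_nonneg_ae (Eventually.of_forall fun x => qR_nonneg _ _ _ _)
    (measurable_qR m c n).aestronglyMeasurable]
  simp_rw [ofReal_qR]
  rw [setLIntegral_qE h hmn c hA]
  rfl

theorem qR_ae_eq {ν : Measure (ℕ → S)} (h : ν ∈ PEProb S) {m n : ℕ} (hmn : m ≤ n)
    (c : ℕ → S) : qR m c n =ᵐ[ν] ν[(cyl m c).indicator (fun _ => (1 : ℝ)) | invSigma S n] := by
  have := PEProb.isProb h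
  refine ae_eq_condExp_of_forall_setIntegral_eq (invSigma_le n)
    ((integrable_const _).indicator (measurableSet_cyl _ _))
    (fun s _ _ => (integrable_qR ν m c n).integrableOn) ?_
    (measurable_qR_inv m c n).stronglyMeasurable.aestronglyMeasurable
  intro s hs _
  rw [setIntegral_qR h hmn c hs, setIntegral_indicator (measurableSet_cyl _ _)]
  simp

theorem tendsto_qR {ν : Measure (ℕ → S)} (h : ν ∈ PEProb S) (m : ℕ) (c : ℕ → S) :
    Tendsto (fun n => ∫⁻ x, ‖qR m c n x
      - (ν[(cyl m c).indicator (fun _ => (1 : ℝ)) | exSigma S]) x‖ₑ ∂ν) atTop (nhds 0) := by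
  have := PEProb.isProb h
  refine (tendsto_condExp_iInf (μ := ν) (invSigma S) invSigma_anti invSigma_le
    ((cyl m c).indicator (fun _ => (1 : ℝ)))
    ((memLp_const _).indicator (measurableSet_cyl _ _))).congr' ?_
  filter_upwards [eventually_ge_atTop m] with n hn
  refine lintegral_congr_ae ?_
  filter_upwards [qR_ae_eq h hn c] with x hx
  rw [hx]
  rfl

/-- The `L¹` distance of the averages from the constant `ν (cyl m c)`. -/
noncomputable def devA (m : ℕ) (c : ℕ → S) (n : ℕ) (ν : Measure (ℕ → S)) : ℝ≥0∞ :=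
  ∑' w : Fin (n + 1) → S, ‖(qE m c n w).toReal - ν.real (cyl m c)‖ₑ * ν (cyl n (ext n w))

theorem devA_eq (m : ℕ) (c : ℕ → S) (n : ℕ) (ν : Measure (ℕ → S)) :
    devA m c n ν = ∫⁻ x, ‖qR m c n x - ν.real (cyl m c)‖ₑ ∂ν := by
  have := lintegral_pre ν n Set.univ fun w => ‖(qE m c n w).toReal - ν.real (cyl m c)‖ₑ
  simp only [Measure.restrict_univ, Set.univ_inter] at this
  exact this.symm

theorem measurable_devA (m : ℕ) (c : ℕ → S) (n : ℕ) : Measurable (devA m c n) := by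
  refine Measurable.tsum fun w => ?_
  refine Measurable.mul ?_ (Measure.measurable_coe (measurableSet_cyl _ _))
  refine Measurable.enorm (measurable_const.sub ?_)
  exact (Measure.measurable_coe (measurableSet_cyl _ _)).ennreal_toReal

theorem cyl_ext_pre (n : ℕ) (x : ℕ → S) : cyl n (ext n (pre n x)) = cyl n x := by
  rw [← pre_preimage]
  ext y
  exact pre_eq_iff n y x

/-- A measurable sufficient criterion for extremality. -/
def Good (ν : Measure (ℕ → S)) : Prop :=
  ν Set.univ = 1 ∧
  (∀ (n : ℕ) (w w' : Fin (n + 1) → S), WEquiv n w w' →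
    ν (cyl n (ext n w)) = ν (cyl n (ext n w'))) ∧
  ∀ (m : ℕ) (w : Fin (m + 1) → S), liminf (fun n => devA m (ext m w) n ν) atTop = 0

theorem measurableSet_good : MeasurableSet {ν : Measure (ℕ → S) | Good ν} := by
  have hE : {ν : Measure (ℕ → S) | Good ν} = {ν | ν Set.univ = 1} ∩
      ((⋂ n, ⋂ w : Fin (n + 1) → S, ⋂ w' : Fin (n + 1) → S, ⋂ (_ : WEquiv n w w'),
        {ν | ν (cyl n (ext n w)) = ν (cyl n (ext n w'))}) ∩
      ⋂ m, ⋂ w : Fin (m + 1) → S, {ν | liminf (fun n => devA m (ext m w) n ν) atTop = 0}) := by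
    ext ν
    simp [Good]
  rw [hE]
  refine MeasurableSet.inter ?_ (MeasurableSet.inter ?_ ?_)
  · exact Measure.measurable_coe MeasurableSet.univ (measurableSet_singleton 1)
  · refine MeasurableSet.iInter fun n => MeasurableSet.iInter fun w => MeasurableSet.iInter fun w' =>
      MeasurableSet.iInter fun _ => ?_
    exact measurableSet_eq_fun (Measure.measurable_coe (measurableSet_cyl _ _))
      (Measure.measurable_coe (measurableSet_cyl _ _))
  · refine MeasurableSet.iInter fun m => MeasurableSet.iInter fun w => ?_
    have : Measurable fun ν : Measure (ℕ → S) =>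
        liminf (fun n => devA m (ext m w) n ν) atTop :=
      Measurable.liminf fun n => measurable_devA m (ext m w) n
    exact this (measurableSet_singleton 0)

theorem Good.mem {ν : Measure (ℕ → S)} (h : Good ν) : ν ∈ PEProb S := by
  refine ⟨h.1, fun n x y hxy => ?_⟩
  have := h.2.1 n _ _ ((wEquiv_pre n x y).2 hxy)
  rwa [cyl_ext_pre, cyl_ext_pre] at this

theorem Good.eq_of_le {ν σ : Measure (ℕ → S)} (h : Good ν) (hσ : σ ∈ PEProb S) (t : ℝ≥0∞)
    (ht : t ≠ 0) (hle : t • σ ≤ ν) : σ = ν := by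
  have hν := PEProb.isProb h.mem
  have hσ' := PEProb.isProb hσ
  refine cyl_measure_ext _ _ 0 fun m _ c => ?_
  have key : ∀ n, m ≤ n → t * ‖σ.real (cyl m c) - ν.real (cyl m c)‖ₑ
      ≤ devA m (ext m (pre m c)) n ν := by
    intro n hn
    rw [devA_eq, cyl_ext_pre]
    have h1 : ∫ x, (qR m (ext m (pre m c)) n x - ν.real (cyl m c)) ∂σ
        = σ.real (cyl m c) - ν.real (cyl m c) := by
      rw [integral_sub (integrable_qR _ _ _ _) (integrable_const _)]
      have := setIntegral_qR hσ hn (ext m (pre m c)) (A := Set.univ) MeasurableSet.univ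
      rw [cyl_ext_pre, Measure.restrict_univ, Set.univ_inter] at this
      rw [this]
      simp
    rw [← h1]
    calc t * ‖∫ x, (qR m (ext m (pre m c)) n x - ν.real (cyl m c)) ∂σ‖ₑ
        ≤ t * ∫⁻ x, ‖qR m (ext m (pre m c)) n x - ν.real (cyl m c)‖ₑ ∂σ := by
          gcongr
          exact enorm_integral_le_lintegral_enorm _
      _ = ∫⁻ x, ‖qR m (ext m (pre m c)) n x - ν.real (cyl m c)‖ₑ ∂(t • σ) := by
          rw [lintegral_smul_measure]; rfl
      _ ≤ _ := lintegral_mono' hle le_rfl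
  have h0 : t * ‖σ.real (cyl m c) - ν.real (cyl m c)‖ₑ ≤ 0 := by
    rw [← h.2.2 m (pre m c)]
    refine le_liminf_of_le (by isBoundedDefault) ?_
    filter_upwards [eventually_ge_atTop m] with n hn using key n hn
  have h2 : ‖σ.real (cyl m c) - ν.real (cyl m c)‖ₑ = 0 := by
    rcases mul_eq_zero.1 (le_antisymm h0 (by positivity)) with h | h
    · exact absurd h ht
    · exact h
  rw [enorm_eq_zero, sub_eq_zero] at h2
  exact (measureReal_eq_measureReal_iff).1 h2

theorem Good.extreme {ν : Measure (ℕ → S)} (h : Good ν) : IsExtremePE ν := by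
  refine ⟨h.mem, fun μ₁ h1 μ₂ h2 t ht ht1 heq => ?_⟩
  have e1 : μ₁ = ν := h.eq_of_le h1 t ht.ne' (by rw [heq]; exact Measure.le_add_right le_rfl)
  have e2 : μ₂ = ν := h.eq_of_le h2 (1 - t) (tsub_pos_of_lt ht1).ne'
    (by rw [heq]; exact Measure.le_add_left le_rfl)
  rw [e1, e2]

theorem pe_cond {ν : Measure (ℕ → S)} (h : ν ∈ PEProb S) {A : Set (ℕ → S)}
    (hA : MeasurableSet[exSigma S] A) (h0 : ν A ≠ 0) :
    (ν A)⁻¹ • ν.restrict A ∈ PEProb S := by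
  have := PEProb.isProb h
  refine ⟨?_, fun n x y hxy => ?_⟩
  · simp only [Measure.smul_apply, Measure.restrict_apply MeasurableSet.univ, Set.univ_inter,
      smul_eq_mul]
    exact ENNReal.inv_mul_cancel h0 (measure_ne_top _ _)
  · have := pe_inv h hxy (exSigma_le_inv n A hA)
    change (ν A)⁻¹ • ν.restrict A (cyl n x) = (ν A)⁻¹ • ν.restrict A (cyl n y)
    rw [Measure.restrict_apply (measurableSet_cyl _ _),
      Measure.restrict_apply (measurableSet_cyl _ _), Set.inter_comm, this, Set.inter_comm]

theorem IsExtremePE.trivial {ν : Measure (ℕ → S)} (h : IsExtremePE ν) {A : Set (ℕ → S)}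
    (hA : MeasurableSet[exSigma S] A) : ν A = 0 ∨ ν Aᶜ = 0 := by
  by_contra! hcon
  obtain ⟨h0, h1⟩ := hcon
  have hp := PEProb.isProb h.1
  have hAm : MeasurableSet A := exSigma_le A hA
  have hc : ν Aᶜ = 1 - ν A := prob_compl_eq_one_sub hAm
  have hlt : ν A < 1 := by
    rw [hc] at h1
    exact tsub_pos_iff_lt.1 (pos_iff_ne_zero.2 h1)
  have := h.2 _ (pe_cond h.1 hA h0) _ (pe_cond h.1 hA.compl h1) (ν A)
    (pos_iff_ne_zero.2 h0) hlt ?_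
  · have h2 := congrArg (fun σ : Measure (ℕ → S) => σ A) this
    simp only [Measure.smul_apply, Measure.restrict_apply hAm, Set.inter_self,
      Set.inter_compl_self, measure_empty, smul_eq_mul, mul_zero] at h2
    rw [ENNReal.inv_mul_cancel h0 (measure_ne_top _ _)] at h2
    exact one_ne_zero h2
  · rw [← hc, smul_smul, smul_smul, ENNReal.mul_inv_cancel h0 (measure_ne_top _ _),
      ENNReal.mul_inv_cancel h1 (measure_ne_top _ _), one_smul, one_smul,
      Measure.restrict_add_restrict_compl hAm]

theorem IsExtremePE.tendsto_devA {ν : Measure (ℕ → S)} (h : IsExtremePE ν) (m : ℕ) (c : ℕ → S) :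
    Tendsto (fun n => devA m c n ν) atTop (nhds 0) := by
  have hp := PEProb.isProb h.1
  have hce : (fun _ => ν.real (cyl m c)) =ᵐ[ν]
      ν[(cyl m c).indicator (fun _ => (1 : ℝ)) | exSigma S] := by
    refine ae_eq_condExp_of_forall_setIntegral_eq exSigma_le
      ((integrable_const _).indicator (measurableSet_cyl _ _))
      (fun s _ _ => (integrable_const _).integrableOn) ?_
      stronglyMeasurable_const.aestronglyMeasurable
    intro s hs _
    have hsm : MeasurableSet s := exSigma_le s hs
    rw [setIntegral_indicator (measurableSet_cyl _ _)]
    simp only [integral_const, smul_eq_mul, mul_one, measureReal_restrict_apply_univ]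
    rcases h.trivial hs with h0 | h0
    · have h1 : ν (s ∩ cyl m c) = 0 := measure_mono_null Set.inter_subset_left h0
      simp [measureReal_def, h0, h1]
    · have h1 : ν s = 1 := (prob_compl_eq_zero_iff hsm).1 h0
      have h2 : ν (s ∩ cyl m c) = ν (cyl m c) := by
        rw [Set.inter_comm]
        exact measure_inter_conull h0
      simp [measureReal_def, h1, h2]
  refine (tendsto_qR h.1 m c).congr fun n => ?_
  rw [devA_eq]
  refine lintegral_congr_ae ?_
  filter_upwards [hce] with x hx
  rw [← hx]

/-! ### The decomposition -/

variable [Nonempty S]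

open ProbabilityTheory

theorem kernel_set (μ : Measure (ℕ → S)) [IsProbabilityMeasure μ] {A B : Set (ℕ → S)}
    (hA : MeasurableSet[exSigma S] A) (hB : MeasurableSet B) :
    ∫⁻ ω in A, condExpKernel μ (exSigma S) ω B ∂μ = μ (A ∩ B) := by
  have hAm : MeasurableSet A := exSigma_le A hA
  have h1 : ∫ ω in A, (condExpKernel μ (exSigma S) ω).real B ∂μ = μ.real (A ∩ B) := by
    rw [setIntegral_congr_ae (g := μ⟦B | exSigma S⟧) hAm
      ((condExpKernel_ae_eq_condExp exSigma_le hB).mono fun x hx _ => hx),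
      setIntegral_condExp exSigma_le ((integrable_const _).indicator hB) hA,
      setIntegral_indicator hB]
    simp
  have hmeas : Measurable fun ω => condExpKernel μ (exSigma S) ω B :=
    (measurable_condExpKernel hB).mono exSigma_le le_rfl
  rw [show (fun ω => (condExpKernel μ (exSigma S) ω).real B)
    = fun ω => (condExpKernel μ (exSigma S) ω B).toReal from rfl,
    integral_toReal hmeas.aemeasurable (Eventually.of_forall fun ω => measure_lt_top _ _)] at h1
  refine (ENNReal.toReal_eq_toReal_iff' ?_ (measure_ne_top _ _)).1 h1
  refine ne_top_of_le_ne_top (measure_ne_top μ A) ?_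
  calc ∫⁻ ω in A, condExpKernel μ (exSigma S) ω B ∂μ ≤ ∫⁻ ω in A, 1 ∂μ :=
        lintegral_mono fun ω => prob_le_one
    _ = μ A := by simp

theorem kernel_mul (μ : Measure (ℕ → S)) [IsProbabilityMeasure μ] {B : Set (ℕ → S)}
    (hB : MeasurableSet B) (F : (ℕ → S) → ℝ≥0∞) (hF : Measurable[exSigma S] F) :
    ∫⁻ ω, F ω * condExpKernel μ (exSigma S) ω B ∂μ = ∫⁻ ω in B, F ω ∂μ := by
  have hmeas : Measurable fun ω => condExpKernel μ (exSigma S) ω B :=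
    (measurable_condExpKernel hB).mono exSigma_le le_rfl
  have hFm : Measurable F := hF.mono exSigma_le le_rfl
  have htrim : (μ.withDensity fun ω => condExpKernel μ (exSigma S) ω B).trim exSigma_le
      = (μ.restrict B).trim exSigma_le := by
    refine @Measure.ext _ (exSigma S) _ _ fun A hA => ?_
    rw [trim_measurableSet_eq _ hA, trim_measurableSet_eq _ hA,
      withDensity_apply _ (exSigma_le A hA), kernel_set μ hA hB,
      Measure.restrict_apply (exSigma_le A hA)]
  rw [← lintegral_trim exSigma_le hF, ← htrim, lintegral_trim exSigma_le hF,
    lintegral_withDensity_eq_lintegral_mul _ hmeas hFm]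
  refine lintegral_congr fun ω => ?_
  simp [mul_comm]

theorem kernel_measurable (μ : Measure (ℕ → S)) [IsProbabilityMeasure μ] :
    Measurable fun ω => condExpKernel μ (exSigma S) ω :=
  (condExpKernel μ (exSigma S)).measurable.mono exSigma_le le_rfl

theorem kernel_tendsto {μ : Measure (ℕ → S)} [IsProbabilityMeasure μ] (hμ : μ ∈ PEProb S)
    (m : ℕ) (c : ℕ → S) :
    Tendsto (fun n => ∫⁻ x, ‖qR m c n x
      - (condExpKernel μ (exSigma S) x).real (cyl m c)‖ₑ ∂μ) atTop (nhds 0) := by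
  refine (tendsto_qR hμ m c).congr fun n => ?_
  refine lintegral_congr_ae ?_
  filter_upwards [condExpKernel_ae_eq_condExp (μ := μ) exSigma_le (measurableSet_cyl m c)] with x hx
  rw [hx]

theorem kernel_devA (μ : Measure (ℕ → S)) [IsProbabilityMeasure μ] (m : ℕ) (c : ℕ → S) (n : ℕ) :
    ∫⁻ ω, devA m c n (condExpKernel μ (exSigma S) ω) ∂μ
      = ∫⁻ x, ‖qR m c n x - (condExpKernel μ (exSigma S) x).real (cyl m c)‖ₑ ∂μ := by
  have hg : Measurable[exSigma S] fun ω => (condExpKernel μ (exSigma S) ω).real (cyl m c) :=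
    (measurable_condExpKernel (measurableSet_cyl m c)).ennreal_toReal
  have hF : ∀ a : ℝ, Measurable[exSigma S] fun ω =>
      ‖a - (condExpKernel μ (exSigma S) ω).real (cyl m c)‖ₑ := fun a =>
    measurable_enorm.comp (measurable_const.sub hg)
  unfold devA
  rw [lintegral_tsum]
  · simp_rw [fun w : Fin (n + 1) → S => kernel_mul μ (measurableSet_cyl n (ext n w)) _
      (hF (qE m c n w).toReal)]
    have h2 : ∀ w : Fin (n + 1) → S, ∫⁻ ω in cyl n (ext n w),
        ‖(qE m c n w).toReal - (condExpKernel μ (exSigma S) ω).real (cyl m c)‖ₑ ∂μ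
        = ∫⁻ ω in cyl n (ext n w),
        ‖qR m c n ω - (condExpKernel μ (exSigma S) ω).real (cyl m c)‖ₑ ∂μ := by
      intro w
      refine setLIntegral_congr_fun (measurableSet_cyl _ _) ?_
      intro ω hω
      have : pre n ω = w := by
        rw [← pre_preimage] at hω
        exact hω
      simp only [qR, this]
    simp_rw [h2]
    rw [← lintegral_iUnion]
    · have : (⋃ w : Fin (n + 1) → S, cyl n (ext n w)) = Set.univ := by
        ext x
        simp [← pre_preimage]
      rw [this, Measure.restrict_univ]
    · exact fun w => measurableSet_cyl _ _
    · intro w w' hww'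
      simp only [Function.onFun, ← pre_preimage]
      rw [Set.disjoint_left]
      intro x h1 h2
      exact hww' (h1.symm.trans h2)
  · intro w
    refine Measurable.aemeasurable ?_
    exact ((hF _).mono exSigma_le le_rfl).mul
      ((measurable_condExpKernel (measurableSet_cyl _ _)).mono exSigma_le le_rfl)

theorem liminf_zero_of_lintegral {α : Type*} [MeasurableSpace α] (μ : Measure α)
    (f : ℕ → α → ℝ≥0∞) (hf : ∀ n, Measurable (f n))
    (h : Tendsto (fun n => ∫⁻ x, f n x ∂μ) atTop (nhds 0)) :
    ∀ᵐ x ∂μ, liminf (fun n => f n x) atTop = 0 := by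
  have h1 : ∫⁻ x, liminf (fun n => f n x) atTop ∂μ = 0 := by
    refine le_antisymm ?_ (by positivity)
    refine (lintegral_liminf_le hf).trans ?_
    rw [h.liminf_eq]
  exact (lintegral_eq_zero_iff (Measurable.liminf hf)).1 h1

theorem kernel_good {μ : Measure (ℕ → S)} [IsProbabilityMeasure μ] (hμ : μ ∈ PEProb S) :
    ∀ᵐ ω ∂μ, Good (condExpKernel μ (exSigma S) ω) := by
  have h1 : ∀ᵐ ω ∂μ, ∀ (n : ℕ) (w w' : Fin (n + 1) → S), WEquiv n w w' →
      condExpKernel μ (exSigma S) ω (cyl n (ext n w))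
        = condExpKernel μ (exSigma S) ω (cyl n (ext n w')) := by
    refine ae_all_iff.2 fun n => ae_all_iff.2 fun w => ae_all_iff.2 fun w' => ?_
    by_cases hw : WEquiv n w w'
    swap
    · exact Eventually.of_forall fun _ H => absurd H hw
    have h2 : μ⟦cyl n (ext n w) | exSigma S⟧ =ᵐ[μ] μ⟦cyl n (ext n w') | exSigma S⟧ := by
      refine ae_eq_condExp_of_forall_setIntegral_eq exSigma_le
        ((integrable_const _).indicator (measurableSet_cyl _ _))
        (fun s _ _ => integrable_condExp.integrableOn) ?_
        stronglyMeasurable_condExp.aestronglyMeasurable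
      intro s hs _
      rw [setIntegral_condExp exSigma_le
        ((integrable_const _).indicator (measurableSet_cyl _ _)) hs,
        setIntegral_indicator (measurableSet_cyl _ _),
        setIntegral_indicator (measurableSet_cyl _ _)]
      simp [measureReal_def, pe_inv hμ hw (exSigma_le_inv n s hs)]
    filter_upwards [h2, condExpKernel_ae_eq_condExp (μ := μ) exSigma_le
      (measurableSet_cyl n (ext n w)), condExpKernel_ae_eq_condExp (μ := μ) exSigma_le
      (measurableSet_cyl n (ext n w'))] with ω e1 e2 e3 _
    refine (measureReal_eq_measureReal_iff).1 ?_
    rw [e2, e3, e1]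
  have h3 : ∀ᵐ ω ∂μ, ∀ (m : ℕ) (w : Fin (m + 1) → S),
      liminf (fun n => devA m (ext m w) n (condExpKernel μ (exSigma S) ω)) atTop = 0 := by
    refine ae_all_iff.2 fun m => ae_all_iff.2 fun w => ?_
    refine liminf_zero_of_lintegral μ
      (fun n ω => devA m (ext m w) n (condExpKernel μ (exSigma S) ω))
      (fun n => (measurable_devA _ _ _).comp (kernel_measurable μ)) ?_
    simp_rw [kernel_devA]
    exact kernel_tendsto hμ m (ext m w)
  filter_upwards [h1, h3] with ω e1 e3
  exact ⟨measure_univ, e1, e3⟩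

theorem kernel_unique {μ : Measure (ℕ → S)} [IsProbabilityMeasure μ] (hμ : μ ∈ PEProb S)
    (lam : Measure (Measure (ℕ → S))) (hext : ∀ᵐ ν ∂lam, IsExtremePE ν)
    (hbar : ∀ A : Set (ℕ → S), MeasurableSet A → μ A = ∫⁻ ν, ν A ∂lam) :
    lam = μ.map fun ω => condExpKernel μ (exSigma S) ω := by
  have hjoin : μ = lam.join := by
    refine Measure.ext fun A hA => ?_
    rw [Measure.join_apply hA, hbar A hA]
  have hgm : ∀ (m : ℕ) (c : ℕ → S), Measurable fun ω =>
      (condExpKernel μ (exSigma S) ω).real (cyl m c) := fun m c =>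
    ((measurable_condExpKernel (measurableSet_cyl m c)).mono exSigma_le le_rfl).ennreal_toReal
  have h1 : ∀ᵐ ν ∂lam, ∀ (m : ℕ) (w : Fin (m + 1) → S), liminf (fun n =>
      ∫⁻ x, ‖qR m (ext m w) n x
        - (condExpKernel μ (exSigma S) x).real (cyl m (ext m w))‖ₑ ∂ν) atTop = 0 := by
    refine ae_all_iff.2 fun m => ae_all_iff.2 fun w => ?_
    have hhm : ∀ n, Measurable fun x => ‖qR m (ext m w) n x
        - (condExpKernel μ (exSigma S) x).real (cyl m (ext m w))‖ₑ := fun n =>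
      ((measurable_qR _ _ _).sub (hgm _ _)).enorm
    refine liminf_zero_of_lintegral lam _
      (fun n => Measure.measurable_lintegral (hhm n)) ?_
    refine (kernel_tendsto hμ m (ext m w)).congr fun n => ?_
    conv_lhs => rw [show (∫⁻ x, ‖qR m (ext m w) n x
        - (condExpKernel μ (exSigma S) x).real (cyl m (ext m w))‖ₑ ∂μ)
        = ∫⁻ x, ‖qR m (ext m w) n x
        - (condExpKernel μ (exSigma S) x).real (cyl m (ext m w))‖ₑ ∂lam.join by rw [← hjoin]]
    exact Measure.lintegral_join (hhm n).aemeasurable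
  have h2 : ∀ᵐ ν ∂lam, ∀ᵐ x ∂ν, condExpKernel μ (exSigma S) x = ν := by
    filter_upwards [h1, hext] with ν hν hνe
    have hp := PEProb.isProb hνe.1
    have h3 : ∀ᵐ x ∂ν, ∀ (m : ℕ) (w : Fin (m + 1) → S),
        (condExpKernel μ (exSigma S) x).real (cyl m (ext m w)) = ν.real (cyl m (ext m w)) := by
      refine ae_all_iff.2 fun m => ae_all_iff.2 fun w => ?_
      have h4 : ∫⁻ x, ‖(condExpKernel μ (exSigma S) x).real (cyl m (ext m w))
          - ν.real (cyl m (ext m w))‖ₑ ∂ν = 0 := by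
        have hle : ∀ n, ∫⁻ x, ‖(condExpKernel μ (exSigma S) x).real (cyl m (ext m w))
          - ν.real (cyl m (ext m w))‖ₑ ∂ν ≤ (∫⁻ x, ‖qR m (ext m w) n x
            - (condExpKernel μ (exSigma S) x).real (cyl m (ext m w))‖ₑ ∂ν)
            + devA m (ext m w) n ν := by
          intro n
          have hmeas1 : Measurable fun x => ‖qR m (ext m w) n x
              - (condExpKernel μ (exSigma S) x).real (cyl m (ext m w))‖ₑ :=
            ((measurable_qR _ _ _).sub (hgm _ _)).enorm
          rw [devA_eq, ← lintegral_add_left hmeas1]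
          refine lintegral_mono fun x => ?_
          simp only [← edist_eq_enorm_sub]
          exact (edist_triangle_left _ _ (qR m (ext m w) n x))
        by_contra hne
        have hpos : 0 < (∫⁻ x, ‖(condExpKernel μ (exSigma S) x).real (cyl m (ext m w))
          - ν.real (cyl m (ext m w))‖ₑ ∂ν) / 2 := ENNReal.half_pos hne
        have hf1 : ∃ᶠ n in atTop, ∫⁻ x, ‖qR m (ext m w) n x
            - (condExpKernel μ (exSigma S) x).real (cyl m (ext m w))‖ₑ ∂ν
            < (∫⁻ x, ‖(condExpKernel μ (exSigma S) x).real (cyl m (ext m w))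
          - ν.real (cyl m (ext m w))‖ₑ ∂ν) / 2 := by
          refine frequently_lt_of_liminf_lt (by isBoundedDefault) ?_
          rw [hν m w]; exact hpos
        have hf2 := (hνe.tendsto_devA m (ext m w)).eventually (gt_mem_nhds hpos)
        obtain ⟨n, hn1, hn2⟩ := (hf1.and_eventually hf2).exists
        have := (hle n).trans_lt (ENNReal.add_lt_add hn1 hn2)
        rw [ENNReal.add_halves] at this
        exact lt_irrefl _ this
      have hmeas2 : Measurable fun x => ‖(condExpKernel μ (exSigma S) x).real (cyl m (ext m w))
          - ν.real (cyl m (ext m w))‖ₑ := ((hgm _ _).sub measurable_const).enorm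
      rw [lintegral_eq_zero_iff hmeas2] at h4
      filter_upwards [h4] with x hx
      simpa [sub_eq_zero] using hx
    filter_upwards [h3] with x hx
    refine cyl_measure_ext _ _ 0 fun m _ c => ?_
    have := hx m (pre m c)
    rw [cyl_ext_pre] at this
    exact (measureReal_eq_measureReal_iff).1 this
  refine Measure.ext fun B hB => ?_
  rw [Measure.map_apply (kernel_measurable μ) hB, hbar _ (kernel_measurable μ hB),
    ← lintegral_indicator_one hB]
  refine lintegral_congr_ae ?_
  filter_upwards [h2, hext] with ν hν hνe
  have hp := PEProb.isProb hνe.1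
  by_cases hνB : ν ∈ B
  · rw [Set.indicator_of_mem hνB]
    symm
    refine (prob_compl_eq_zero_iff (kernel_measurable μ hB)).1 ?_
    refine measure_mono_null ?_ hν
    intro x hx hxν
    have e : condExpKernel μ (exSigma S) x = ν := hxν
    exact hx (show condExpKernel μ (exSigma S) x ∈ B by rw [e]; exact hνB)
  · rw [Set.indicator_of_notMem hνB]
    symm
    refine measure_mono_null ?_ hν
    intro x hx hxν
    have e : condExpKernel μ (exSigma S) x = ν := hxν
    have hx' : condExpKernel μ (exSigma S) x ∈ B := hx
    rw [e] at hx'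
    exact hνB hx'

end Meas


/-- The set of partially exchangeable probability measures on `S^ℕ` is a
Choquet simplex: every partially exchangeable probability measure is the barycentre of a unique
probability measure concentrated on the extreme points. -/
theorem stmt5 {S : Type} [Countable S] [Nonempty S] [MeasurableSpace S]
    [DiscreteMeasurableSpace S]
    (μ : Measure (ℕ → S)) (hμ : μ ∈ PEProb S) :
    ∃! lam : Measure (Measure (ℕ → S)),
      lam Set.univ = 1 ∧ lam {ν | ¬IsExtremePE ν} = 0 ∧
        ∀ A : Set (ℕ → S), MeasurableSet A → μ A = ∫⁻ ν, ν A ∂lam := by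
  have hp := PEProb.isProb hμ
  refine ⟨μ.map fun ω => ProbabilityTheory.condExpKernel μ (exSigma S) ω, ⟨?_, ?_, ?_⟩, ?_⟩
  · rw [Measure.map_apply (kernel_measurable μ) MeasurableSet.univ]
    simp
  · refine measure_mono_null (t := {ν | Good ν}ᶜ) (fun ν hν hg => hν (Good.extreme hg)) ?_
    rw [Measure.map_apply (kernel_measurable μ) measurableSet_good.compl]
    exact kernel_good hμ
  · intro A hA
    rw [lintegral_map (Measure.measurable_coe hA) (kernel_measurable μ)]
    have := kernel_set μ (A := Set.univ) (B := A) MeasurableSet.univ hA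
    rw [Measure.restrict_univ, Set.univ_inter] at this
    exact this.symm
  · rintro lam ⟨_, h2, h3⟩
    exact kernel_unique hμ lam h2 h3

end DF
end

section
/- Let S be a countable set and let X be a partially exchangeable process taking values in S such that every state s ∈ S is either recurrent (visited infinitely often by X almost surely) or transient (visited finitely often by X almost surely). Then almost surely no transient state is visited after a recurrent state: with probability one there are no indices i < j such that X_i is a recurrent state and X_j is a transient state. -/
open MeasureTheory Filter Set
open scoped ENNReal

namespace DF

/-! ### Sequences over a countable state space -/

variable {S : Type}

/-- Swapping two consecutive blocks of lengths `p`, `q` starting at position `a`. -/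
def swapFun (a p q i : ℕ) : ℕ :=
  if i < a then i else if i < a + q then i + p else if i < a + p + q then i - q else i

theorem swapFun_swapFun (a p q i : ℕ) : swapFun a p q (swapFun a q p i) = i := by
  unfold swapFun
  split_ifs <;> omega

theorem swapFun_injective (a p q : ℕ) : Function.Injective (swapFun a p q) :=
  Function.LeftInverse.injective (g := swapFun a q p) (fun i => swapFun_swapFun a q p i)

theorem swap_finEquiv (x : ℕ → S) (r : S) (a p q : ℕ) (hp : 0 < p) (hq : 0 < q) (ha : x a = r)
    (hb : x (a + p) = r) (hc : x (a + p + q) = r) :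
    FinEquiv x (x ∘ swapFun a p q) (a + p + q) := by
  have key : ∀ i < a + p + q, x (swapFun a p q i + 1) = x (swapFun a p q (i + 1)) := by
    intro i hi
    by_cases h1 : i + 1 = a
    · have e1 : swapFun a p q i + 1 = a := by unfold swapFun; split_ifs <;> omega
      have e2 : swapFun a p q (i + 1) = a + p := by unfold swapFun; split_ifs <;> omega
      rw [e1, e2, ha, hb]
    by_cases h2 : i + 1 = a + q
    · have e1 : swapFun a p q i + 1 = a + p + q := by unfold swapFun; split_ifs <;> omega
      have e2 : swapFun a p q (i + 1) = a := by unfold swapFun; split_ifs <;> omega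
      rw [e1, e2, ha, hc]
    by_cases h3 : i + 1 = a + p + q
    · have e1 : swapFun a p q i + 1 = a + p := by unfold swapFun; split_ifs <;> omega
      have e2 : swapFun a p q (i + 1) = a + p + q := by unfold swapFun; split_ifs <;> omega
      rw [e1, e2, hb, hc]
    congr 1
    unfold swapFun; split_ifs <;> omega
  constructor
  · by_cases h : a = 0
    · subst h
      have : swapFun 0 p q 0 = 0 + p := by unfold swapFun; split_ifs <;> omega
      simp only [Function.comp, this, ha, hb]
    · have : swapFun a p q 0 = 0 := by unfold swapFun; split_ifs <;> omega
      simp only [Function.comp, this]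
  · intro u v
    unfold transCount
    symm
    rw [← Set.ncard_image_of_injective _ (swapFun_injective a p q)]
    congr 1
    ext j
    rw [Iff.comm]
    simp only [Set.mem_ofPred_eq, Set.mem_image, Function.comp]
    constructor
    · rintro ⟨hj, h1, h2⟩
      have hlt : swapFun a q p j < a + p + q := by unfold swapFun; split_ifs <;> omega
      refine ⟨swapFun a q p j, ⟨hlt, ?_, ?_⟩, swapFun_swapFun a p q j⟩
      · rw [swapFun_swapFun]; exact h1
      · rw [← key _ hlt, swapFun_swapFun]; exact h2
    · rintro ⟨i, ⟨hi, h1, h2⟩, rfl⟩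
      refine ⟨?_, h1, ?_⟩
      · unfold swapFun; split_ifs <;> omega
      · rw [key i hi]; exact h2

/-- Comparison of probabilities of events that depend on finitely many coordinates. -/
theorem measure_le_of_reindex [Countable S] [MeasurableSpace S] [DiscreteMeasurableSpace S]
    (μ : Measure (ℕ → S)) (hPE : PartiallyExchangeable μ) (n : ℕ) (f : ℕ → ℕ)
    (hf : ∀ i ≤ n, f i ≤ n) (hfs : ∀ j ≤ n, ∃ i ≤ n, f i = j) (F G : Set (ℕ → S))
    (hF : ∀ x y, (∀ i ≤ n, x i = y i) → x ∈ F → y ∈ F)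
    (hG : ∀ x y, (∀ i ≤ n, x i = y i) → x ∈ G → y ∈ G)
    (h : ∀ x ∈ F, x ∘ f ∈ G ∧ FinEquiv x (x ∘ f) n) : μ F ≤ μ G := by
  let W := Fin (n + 1) → S
  let ext : W → ℕ → S := fun w i => w ⟨min i n, by omega⟩
  let res : (ℕ → S) → W := fun x i => x i
  have hres : Measurable res := by
    apply measurable_pi_lambda
    intro i
    exact measurable_pi_apply _
  have hext : ∀ x : ℕ → S, ∀ i ≤ n, ext (res x) i = x i := by
    intro x i hi
    simp [ext, res, hi]
  have hcyl : ∀ w : W, {x : ℕ → S | ∀ i ≤ n, x i = ext w i} = res ⁻¹' {w} := by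
    intro w
    ext x
    simp only [Set.mem_ofPred_eq, Set.mem_preimage, Set.mem_singleton_iff]
    constructor
    · intro hx
      funext i
      have := hx i (by omega)
      have h2 : min (i : ℕ) n = i := by omega
      simpa [res, ext, h2] using this
    · rintro rfl i hi
      exact (hext x i hi).symm
  have hdec : ∀ H : Set (ℕ → S), (∀ x y, (∀ i ≤ n, x i = y i) → x ∈ H → y ∈ H) →
      μ H = ∑' w : {w : W // ext w ∈ H}, μ {x | ∀ i ≤ n, x i = ext w.1 i} := by
    intro H hH
    have hU : H = ⋃ w : {w : W // ext w ∈ H}, {x | ∀ i ≤ n, x i = ext w.1 i} := by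
      ext x
      simp only [Set.mem_iUnion, Set.mem_ofPred_eq]
      constructor
      · intro hx
        exact ⟨⟨res x, hH _ _ (fun i hi => (hext x i hi).symm) hx⟩,
          fun i hi => (hext x i hi).symm⟩
      · rintro ⟨⟨w, hw⟩, hx⟩
        exact hH _ _ (fun i hi => (hx i hi).symm) hw
    conv_lhs => rw [hU]
    rw [measure_iUnion]
    · intro w w' hne
      simp only [Function.onFun]
      rw [hcyl, hcyl]
      apply Disjoint.preimage
      simp only [Set.disjoint_singleton]
      exact fun hh => hne (Subtype.ext hh)
    · intro w
      rw [hcyl]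
      exact hres (measurableSet_singleton _)
  rw [hdec F hF, hdec G hG]
  have hφ : ∀ w : W, ∀ i ≤ n, ext (res (ext w ∘ f)) i = (ext w ∘ f) i := fun w => hext _
  let φ : {w : W // ext w ∈ F} → {w : W // ext w ∈ G} := fun w =>
    ⟨res (ext w.1 ∘ f), hG _ _ (fun i hi => (hφ w.1 i hi).symm) (h _ w.2).1⟩
  have hinj : Function.Injective φ := by
    rintro ⟨w, hw⟩ ⟨w', hw'⟩ he
    have he' : res (ext w ∘ f) = res (ext w' ∘ f) := congrArg Subtype.val he
    apply Subtype.ext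
    funext j
    obtain ⟨i, hi, hij⟩ := hfs j (by omega)
    have h1 := congrFun he' ⟨i, by omega⟩
    have h2 : min (j : ℕ) n = j := by omega
    simpa [res, ext, hij, h2] using h1
  calc _ = ∑' w : {w : W // ext w ∈ F}, μ {x | ∀ i ≤ n, x i = ext (φ w).1 i} := by
        apply tsum_congr
        intro w
        rw [hPE n _ _ (h _ w.2).2]
        congr 1
        ext x
        simp only [Set.mem_ofPred_eq]
        apply forall₂_congr
        intro i hi
        rw [show ext (φ w).1 i = (ext w.1 ∘ f) i from hφ w.1 i hi]
    _ ≤ _ := ENNReal.tsum_comp_le_tsum_of_injective hinj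
      (fun w : {w : W // ext w ∈ G} => μ {x | ∀ i ≤ n, x i = ext w.1 i})

open Classical in
/-- The `k`-th visit to `r` is at time `a`, the next ones at times `a+p` and `a+p+q`. -/
def Dset (r : S) (k a p q : ℕ) : Set (ℕ → S) :=
  {x | Nat.count (fun i => x i = r) a = k ∧ 0 < p ∧ 0 < q ∧ x a = r ∧ x (a + p) = r ∧
    x (a + p + q) = r ∧ (∀ i, a < i → i < a + p → x i ≠ r) ∧
    (∀ i, a + p < i → i < a + p + q → x i ≠ r)}

def F1 (r t : S) (k a p q : ℕ) : Set (ℕ → S) :=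
  Dset r k a p q ∩ {x | ∃ i, a < i ∧ i < a + p ∧ x i = t}

def F2 (r t : S) (k a p q : ℕ) : Set (ℕ → S) :=
  Dset r k a p q ∩ {x | ∃ i, a + p < i ∧ i < a + p + q ∧ x i = t}

theorem count_congr_lt {P Q : ℕ → Prop} [DecidablePred P] [DecidablePred Q] (a : ℕ)
    (h : ∀ i < a, P i ↔ Q i) : Nat.count P a = Nat.count Q a := by
  induction a with
  | zero => simp
  | succ a ih =>
    rw [Nat.count_succ, Nat.count_succ, ih (fun i hi => h i (by omega))]
    simp [h a (by omega)]

theorem Dset_sat (r : S) (k a p q : ℕ) (x y : ℕ → S) (h : ∀ i ≤ a + p + q, x i = y i)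
    (hx : x ∈ Dset r k a p q) : y ∈ Dset r k a p q := by
  classical
  obtain ⟨h1, h2, h3, h4, h5, h6, h7, h8⟩ := hx
  refine ⟨?_, h2, h3, ?_, ?_, ?_, ?_, ?_⟩
  · rw [← h1]
    apply count_congr_lt
    intro i hi
    rw [h i (by omega)]
  · rw [← h _ (by omega)]; exact h4
  · rw [← h _ (by omega)]; exact h5
  · rw [← h _ (by omega)]; exact h6
  · intro i hi hi'
    rw [← h _ (by omega)]; exact h7 i hi hi'
  · intro i hi hi'
    rw [← h _ (by omega)]; exact h8 i hi hi'

theorem Dset_swap (r : S) (k a p q : ℕ) (x : ℕ → S) (hx : x ∈ Dset r k a p q) :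
    x ∘ swapFun a p q ∈ Dset r k a q p := by
  classical
  obtain ⟨h1, h2, h3, h4, h5, h6, h7, h8⟩ := hx
  refine ⟨?_, h3, h2, ?_, ?_, ?_, ?_, ?_⟩
  · rw [← h1]
    apply count_congr_lt
    intro i hi
    have : swapFun a p q i = i := by unfold swapFun; split_ifs <;> omega
    simp [this]
  · have : swapFun a p q a = a + p := by unfold swapFun; split_ifs <;> omega
    simpa [this] using h5
  · have : swapFun a p q (a + q) = a := by unfold swapFun; split_ifs <;> omega
    simpa [this] using h4
  · have : swapFun a p q (a + q + p) = a + p + q := by unfold swapFun; split_ifs <;> omega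
    simpa [this] using h6
  · intro i hi hi'
    exact h8 _ (by unfold swapFun; split_ifs <;> omega) (by unfold swapFun; split_ifs <;> omega)
  · intro i hi hi'
    exact h7 _ (by unfold swapFun; split_ifs <;> omega) (by unfold swapFun; split_ifs <;> omega)

theorem Dset_unique (r : S) (k a p q a' p' q' : ℕ) (x : ℕ → S) (hx : x ∈ Dset r k a p q)
    (hx' : x ∈ Dset r k a' p' q') : a = a' ∧ p = p' ∧ q = q' := by
  classical
  obtain ⟨h1, h2, h3, h4, h5, h6, h7, h8⟩ := hx
  obtain ⟨g1, g2, g3, g4, g5, g6, g7, g8⟩ := hx'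
  have ha : a = a' := by
    rcases lt_trichotomy a a' with hlt | heq | hlt
    · have := Nat.count_strict_mono (p := fun i => x i = r) h4 hlt
      omega
    · exact heq
    · have := Nat.count_strict_mono (p := fun i => x i = r) g4 hlt
      omega
  subst ha
  have hp : p = p' := by
    rcases lt_trichotomy p p' with hlt | heq | hlt
    · exact absurd h5 (g7 _ (by omega) (by omega))
    · exact heq
    · exact absurd g5 (h7 _ (by omega) (by omega))
  subst hp
  have hq : q = q' := by
    rcases lt_trichotomy q q' with hlt | heq | hlt
    · exact absurd h6 (g8 _ (by omega) (by omega))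
    · exact heq
    · exact absurd g6 (h8 _ (by omega) (by omega))
  exact ⟨rfl, rfl, hq⟩

theorem F1_le_F2 [Countable S] [MeasurableSpace S] [DiscreteMeasurableSpace S]
    (μ : Measure (ℕ → S)) (hPE : PartiallyExchangeable μ) (r t : S) (k a p q : ℕ) :
    μ (F1 r t k a p q) ≤ μ (F2 r t k a q p) := by
  apply measure_le_of_reindex μ hPE (a + p + q) (swapFun a p q)
  · intro i hi; unfold swapFun; split_ifs <;> omega
  · intro j hj
    exact ⟨swapFun a q p j, by unfold swapFun; split_ifs <;> omega, swapFun_swapFun a p q j⟩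
  · rintro x y h ⟨hD, i, hi, hi', hit⟩
    exact ⟨Dset_sat r k a p q x y h hD, i, hi, hi', by rw [← h i (by omega)]; exact hit⟩
  · rintro x y h ⟨hD, i, hi, hi', hit⟩
    exact ⟨Dset_sat r k a q p x y (fun i hi => h i (by omega)) hD, i, hi, hi',
      by rw [← h i (by omega)]; exact hit⟩
  · rintro x ⟨hD, i, hi, hi', hit⟩
    refine ⟨⟨Dset_swap r k a p q x hD, i + q, by omega, by omega, ?_⟩, ?_⟩
    · have : swapFun a p q (i + q) = i := by unfold swapFun; split_ifs <;> omega
      simpa [this] using hit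
    · obtain ⟨h1, h2, h3, h4, h5, h6, h7, h8⟩ := hD
      exact swap_finEquiv x r a p q h2 h3 h4 h5 h6

theorem measurableSet_of_sat [Countable S] [MeasurableSpace S] [DiscreteMeasurableSpace S]
    (n : ℕ) (H : Set (ℕ → S)) (hH : ∀ x y, (∀ i ≤ n, x i = y i) → x ∈ H → y ∈ H) :
    MeasurableSet H := by
  let res : (ℕ → S) → (Fin (n + 1) → S) := fun x i => x i
  have hres : Measurable res := by
    apply measurable_pi_lambda
    intro i
    exact measurable_pi_apply _
  have : H = res ⁻¹' (res '' H) := by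
    ext x
    constructor
    · intro hx; exact ⟨x, hx, rfl⟩
    · rintro ⟨y, hy, hyx⟩
      refine hH y x (fun i hi => ?_) hy
      exact congrFun hyx ⟨i, by omega⟩
  rw [this]
  exact hres ((Set.to_countable _).measurableSet)

def E1 (r t : S) (k : ℕ) : Set (ℕ → S) := ⋃ v : ℕ × ℕ × ℕ, F1 r t k v.1 v.2.1 v.2.2

def E2 (r t : S) (k : ℕ) : Set (ℕ → S) := ⋃ v : ℕ × ℕ × ℕ, F2 r t k v.1 v.2.2 v.2.1

theorem E1_le_E2 [Countable S] [MeasurableSpace S] [DiscreteMeasurableSpace S]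
    (μ : Measure (ℕ → S)) (hPE : PartiallyExchangeable μ) (r t : S) (k : ℕ) :
    μ (E1 r t k) ≤ μ (E2 r t k) := by
  unfold E1 E2
  rw [measure_iUnion (f := fun v : ℕ × ℕ × ℕ => F2 r t k v.1 v.2.2 v.2.1)]
  · refine (measure_iUnion_le _).trans ?_
    exact ENNReal.tsum_le_tsum fun v => F1_le_F2 μ hPE r t k _ _ _
  · rintro ⟨a, p, q⟩ ⟨a', p', q'⟩ hne
    simp only [Function.onFun]
    rw [Set.disjoint_left]
    rintro x ⟨hx, -⟩ ⟨hx', -⟩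
    obtain ⟨e1, e2, e3⟩ := Dset_unique _ _ _ _ _ _ _ _ x hx hx'
    exact hne (by rw [e1, e2, e3])
  · rintro ⟨a, p, q⟩
    apply measurableSet_of_sat (a + q + p)
    rintro x y h ⟨hD, i, hi, hi', hit⟩
    exact ⟨Dset_sat r k a q p x y h hD, i, hi, hi', by rw [← h i (by simp only at hi'; omega)]; exact hit⟩

theorem exists_next (x : ℕ → S) (r : S) (hx : {i : ℕ | x i = r}.Infinite) (b : ℕ) :
    ∃ q, 0 < q ∧ x (b + q) = r ∧ ∀ i, b < i → i < b + q → x i ≠ r := by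
  classical
  have hex : ∃ q, 0 < q ∧ x (b + q) = r := by
    obtain ⟨m, hm, hbm⟩ := hx.exists_gt b
    refine ⟨m - b, by omega, ?_⟩
    rw [show b + (m - b) = m by omega]
    exact hm
  refine ⟨Nat.find hex, (Nat.find_spec hex).1, (Nat.find_spec hex).2, ?_⟩
  intro i hi hi' hxi
  refine Nat.find_min hex (m := i - b) (by omega) ⟨by omega, ?_⟩
  rw [show b + (i - b) = i by omega]
  exact hxi

theorem E2_sub (r t : S) (k : ℕ) (x : ℕ → S) (hx : {i : ℕ | x i = r}.Infinite)
    (h : x ∈ E2 r t k) : x ∈ E1 r t (k + 1) := by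
  classical
  simp only [E2, Set.mem_iUnion] at h
  obtain ⟨⟨a, q, p⟩, ⟨h1, h2, h3, h4, h5, h6, h7, h8⟩, i, hi, hi', hit⟩ := h
  simp only at *
  obtain ⟨s, hs, hs', hs''⟩ := exists_next x r hx (a + p + q)
  refine Set.mem_iUnion.2 ⟨(a + p, q, s), ⟨?_, h3, hs, h5, h6, hs', h8, hs''⟩, i, hi, hi', hit⟩
  obtain ⟨p', rfl⟩ : ∃ p', p = p' + 1 := ⟨p - 1, by omega⟩
  have hz : Nat.count (fun i => x (a + 1 + i) = r) p' = 0 := by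
    apply Nat.count_of_forall_not
    intro j hj
    exact h7 _ (by omega) (by omega)
  have e : a + (p' + 1) = (a + 1) + p' := by omega
  simp only [e]
  rw [Nat.count_add, Nat.count_succ]
  simp only [h4, if_true]
  rw [hz]
  have h1' : Nat.count (fun i => x i = r) a = k := by convert h1
  omega

theorem E1_sub (r t : S) (k : ℕ) (x : ℕ → S) (h : x ∈ E1 r t k) : ∃ i ≥ k, x i = t := by
  classical
  simp only [E1, Set.mem_iUnion] at h
  obtain ⟨⟨a, p, q⟩, ⟨h1, -⟩, i, hi, hi', hit⟩ := h
  have := Nat.count_le (p := fun i => x i = r) (n := a)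
  refine ⟨i, ?_, hit⟩
  have h1' : Nat.count (fun i => x i = r) a = k := by convert h1
  simp only at hi
  omega

theorem mem_E1 (r t : S) (hrt : r ≠ t) (x : ℕ → S) (hx : {i : ℕ | x i = r}.Infinite)
    (i j : ℕ) (hij : i < j) (hi : x i = r) (hj : x j = t) : ∃ k, x ∈ E1 r t k := by
  classical
  set a := Nat.findGreatest (fun m => x m = r) j with ha
  have ha1 : x a = r := Nat.findGreatest_spec (P := fun m => x m = r) hij.le hi
  have ha2 : a ≤ j := Nat.findGreatest_le j
  have ha3 : a ≠ j := fun h => hrt (by rw [← ha1, h, hj])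
  obtain ⟨p, hp, hp', hp''⟩ := exists_next x r hx a
  obtain ⟨q, hq, hq', hq''⟩ := exists_next x r hx (a + p)
  refine ⟨Nat.count (fun i => x i = r) a, Set.mem_iUnion.2 ⟨(a, p, q),
    ⟨rfl, hp, hq, ha1, hp', hq', hp'', hq''⟩, j, by simp only; omega, ?_, hj⟩⟩
  by_contra hcon
  simp only [not_lt] at hcon
  exact Nat.findGreatest_is_greatest (P := fun m => x m = r) (n := j) (k := a + p)
    (by omega) hcon hp'

theorem E1_null [Countable S] [MeasurableSpace S] [DiscreteMeasurableSpace S]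
    (μ : Measure (ℕ → S)) [IsProbabilityMeasure μ] (hPE : PartiallyExchangeable μ) (r t : S)
    (hr : ∀ᵐ x ∂μ, {i : ℕ | x i = r}.Infinite) (ht : ∀ᵐ x ∂μ, {i : ℕ | x i = t}.Finite)
    (k : ℕ) : μ (E1 r t k) = 0 := by
  have hmono : Monotone fun k => μ (E1 r t k) := by
    apply monotone_nat_of_le_succ
    intro k
    refine (E1_le_E2 μ hPE r t k).trans (measure_mono_ae ?_)
    filter_upwards [hr] with x hx h
    exact E2_sub r t k x hx h
  let V : ℕ → Set (ℕ → S) := fun m => {x | ∃ i ≥ m, x i = t}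
  have hVm : ∀ m, MeasurableSet (V m) := by
    intro m
    have : V m = ⋃ i : ℕ, ⋃ _ : i ≥ m, (fun x : ℕ → S => x i) ⁻¹' {t} := by
      ext x; simp [V]
    rw [this]
    exact MeasurableSet.iUnion fun i => MeasurableSet.iUnion fun _ =>
      measurable_pi_apply i (measurableSet_singleton t)
  have hanti : Antitone V := by
    rintro m m' hm x ⟨i, hi, hit⟩
    exact ⟨i, le_trans hm hi, hit⟩
  have hlim := tendsto_measure_iInter_atTop (μ := μ) (s := V)
    (fun m => (hVm m).nullMeasurableSet) hanti ⟨0, measure_ne_top _ _⟩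
  have hz : μ (⋂ m, V m) = 0 := by
    rw [measure_eq_zero_iff_ae_notMem]
    filter_upwards [ht] with x hx hV
    obtain ⟨M, hM⟩ := hx.bddAbove
    obtain ⟨i, hi, hit⟩ := Set.mem_iInter.1 hV (M + 1)
    have := hM hit
    omega
  rw [hz] at hlim
  refine le_antisymm (ge_of_tendsto hlim ?_) zero_le
  filter_upwards [Filter.eventually_ge_atTop k] with m hm
  exact (hmono hm).trans (measure_mono fun x hx => E1_sub r t m x hx)

theorem measurableSet_fin [Countable S] [MeasurableSpace S] [DiscreteMeasurableSpace S] (s : S) :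
    MeasurableSet {x : ℕ → S | {i : ℕ | x i = s}.Finite} := by
  have : {x : ℕ → S | {i : ℕ | x i = s}.Finite} =
      ⋃ M : ℕ, ⋂ i : ℕ, ⋂ _ : M < i, ((fun x : ℕ → S => x i) ⁻¹' {s})ᶜ := by
    ext x
    simp only [Set.mem_ofPred_eq, Set.mem_iUnion, Set.mem_iInter, Set.mem_compl_iff,
      Set.mem_preimage, Set.mem_singleton_iff]
    constructor
    · intro h
      obtain ⟨M, hM⟩ := h.bddAbove
      exact ⟨M, fun i hi hit => absurd (hM hit) (by omega)⟩
    · rintro ⟨M, hM⟩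
      apply (Set.finite_Iic M).subset
      intro i hi
      by_contra hcon
      exact hM i (by simpa using hcon) hi
  rw [this]
  exact MeasurableSet.iUnion fun M => MeasurableSet.iInter fun i => MeasurableSet.iInter fun _ =>
    (measurable_pi_apply i (measurableSet_singleton s)).compl

/-- For a partially exchangeable process in which every state is either
recurrent (visited infinitely often a.s.) or transient (visited finitely often a.s.), almost
surely no transient state is visited after a recurrent state. -/
theorem stmt7 {S : Type} [Countable S] [MeasurableSpace S] [DiscreteMeasurableSpace S]
    (μ : Measure (ℕ → S)) (hprob : μ Set.univ = 1) (hPE : PartiallyExchangeable μ)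
    (hdich : ∀ s : S,
      μ {x | {i : ℕ | x i = s}.Infinite} = 1 ∨ μ {x | {i : ℕ | x i = s}.Finite} = 1) :
    μ {x | ∃ i j : ℕ, i < j ∧ μ {y | {k : ℕ | y k = x i}.Infinite} = 1 ∧
        μ {y | {k : ℕ | y k = x j}.Finite} = 1} = 0 := by
  haveI : IsProbabilityMeasure μ := ⟨hprob⟩
  have hfin : ∀ s : S, μ {x | {i : ℕ | x i = s}.Finite} = 1 →
      ∀ᵐ x ∂μ, {i : ℕ | x i = s}.Finite := fun s hs =>
    (mem_ae_iff_prob_eq_one (measurableSet_fin s)).2 hs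
  have hinf : ∀ s : S, μ {x | {i : ℕ | x i = s}.Infinite} = 1 →
      ∀ᵐ x ∂μ, {i : ℕ | x i = s}.Infinite := fun s hs =>
    (mem_ae_iff_prob_eq_one (measurableSet_fin s).compl).2 hs
  have hall : ∀ᵐ x ∂μ, ∀ r t : S, μ {y | {k : ℕ | y k = r}.Infinite} = 1 →
      μ {y | {k : ℕ | y k = t}.Finite} = 1 →
      {i : ℕ | x i = r}.Infinite ∧ {i : ℕ | x i = t}.Finite ∧ ∀ k, x ∉ E1 r t k := by
    rw [ae_all_iff]
    intro r
    rw [ae_all_iff]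
    intro t
    by_cases hr : μ {y | {k : ℕ | y k = r}.Infinite} = 1
    · by_cases ht : μ {y | {k : ℕ | y k = t}.Finite} = 1
      · have hE : ∀ᵐ x ∂μ, ∀ k, x ∉ E1 r t k := ae_all_iff.2 fun k =>
          measure_eq_zero_iff_ae_notMem.1 (E1_null μ hPE r t (hinf r hr) (hfin t ht) k)
        filter_upwards [hinf r hr, hfin t ht, hE] with x h1 h2 h3 _ _
        exact ⟨h1, h2, h3⟩
      · exact Filter.Eventually.of_forall fun x _ h => absurd h ht
    · exact Filter.Eventually.of_forall fun x h => absurd h hr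
  rw [measure_eq_zero_iff_ae_notMem]
  filter_upwards [hall] with x hx
  rintro ⟨i, j, hij, hr, ht⟩
  obtain ⟨h1, h2, h3⟩ := hx (x i) (x j) hr ht
  have hne : x i ≠ x j := by
    intro h
    rw [h] at h1
    exact h1 h2
  obtain ⟨k, hk⟩ := mem_E1 (x i) (x j) hne x h1 i j hij rfl rfl
  exact h3 k hk

end DF
end

section
/- Let (G, o, z) be a finite Eulerian digraph with source o and sink z. A stack configuration S on G in which, for each vertex v, the list S(v) includes each outgoing edge of v exactly once represents an Eulerian path from o to z if and only if the set of edges at the bottoms of the stacks at the vertices other than z forms a spanning in-arborescence of G rooted at z. Consequently, the number of Eulerian paths from o to z equals |𝒜^in_z(G)| · out-deg(z)! · ∏_{v ∈ V∖{z}} (out-deg(v) − 1)!, where 𝒜^in_z(G) is the set of spanning in-arborescences of G rooted at z. -/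
open MeasureTheory Filter Set
open scoped ENNReal

namespace DF

/-! ### Sequences over a countable state space -/

variable {S : Type}

section BestHelpers

/-- Stack configurations listing each outgoing edge once. -/
def BValid {V E : Type} (G : DigraphStruct V E) (St : V → List E) : Prop :=
  ∀ v : V, (St v).Nodup ∧ ∀ e : E, e ∈ St v ↔ G.src e = v

/-- Bottom edges of the stacks away from `z`. -/
def bBot {V E : Type} (z : V) (St : V → List E) : Set E :=
  {e : E | ∃ v : V, v ≠ z ∧ (St v).getLast? = some e}

theorem b_reach {V E : Type} [DecidableEq V] (G : DigraphStruct V E) (z : V) (B : Set E) :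
    ∀ (P : List E) (o : V), IsPathList G o z P →
      (∀ v e, v ≠ z → (P.filter fun e => decide (G.src e = v)).getLast? = some e → e ∈ B) →
      ∀ v, (v = o ∨ ∃ e ∈ P, G.src e = v) → Relation.ReflTransGen (G.step B) v z := by
  intro P
  induction P with
  | nil =>
    intro o h _ v hv
    simp [IsPathList] at h hv
    subst h; subst hv; exact .refl
  | cons e es ih =>
    intro o h hB v hv
    obtain ⟨h1, h2⟩ := h
    have ih' := ih (G.dst e) h2 (by
      intro w f hw hf
      apply hB w f hw
      rw [List.filter_cons]
      split
      · rw [List.getLast?_cons, hf]; rfl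
      · exact hf)
    by_cases hz : v = z
    · subst hz; exact .refl
    by_cases hes : ∃ f ∈ es, G.src f = v
    · exact ih' v (Or.inr hes)
    have hv' : G.src e = v := by
      rcases hv with hv | ⟨f, hf, hfv⟩
      · rw [h1, hv]
      · rcases List.mem_cons.1 hf with rfl | hf
        · exact hfv
        · exact absurd ⟨f, hf, hfv⟩ hes
    have heB : e ∈ B := by
      apply hB v e hz
      have : es.filter (fun e => decide (G.src e = v)) = [] := by
        rw [List.filter_eq_nil_iff]
        intro f hf; simp only [decide_eq_true_eq]
        intro h; exact hes ⟨f, hf, h⟩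
      rw [List.filter_cons, if_pos (by simpa using hv'), this]; rfl
    exact Relation.ReflTransGen.head ⟨e, heB, hv', rfl⟩ (ih' _ (Or.inl rfl))

theorem b_balance {V E : Type} [DecidableEq V] (G : DigraphStruct V E) (z : V) (v : V) :
    ∀ (P : List E) (o : V), IsPathList G o z P →
      (P.filter fun e => decide (G.src e = v)).length + (if v = z then 1 else 0) =
      (P.filter fun e => decide (G.dst e = v)).length + (if v = o then 1 else 0) := by
  intro P
  induction P with
  | nil => intro o h; simp [IsPathList] at h; subst h; simp
  | cons e es ih =>
    intro o h
    obtain ⟨h1, h2⟩ := h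
    have := ih _ h2
    subst h1
    simp only [List.filter_cons, decide_eq_true_eq]
    simp only [eq_comm (a := v)] at this ⊢
    split_ifs at this ⊢ <;> (try simp only [List.length_cons]) <;> omega

theorem b_run {V E : Type} [Fintype V] [DecidableEq V] (G : DigraphStruct V E) :
    ∀ (n : ℕ) (σ : V → List E), (∑ v, (σ v).length = n) →
      (∀ v, ∀ e ∈ σ v, G.src e = v) → ∀ o : V,
      ∃ (z : V) (P : List E) (σ' : V → List E), IsPathList G o z P ∧ σ' z = [] ∧
        ∀ v, σ v = (P.filter fun e => decide (G.src e = v)) ++ σ' v := by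
  intro n
  induction n with
  | zero =>
    intro σ hs _ o
    refine ⟨o, [], σ, rfl, ?_, by simp⟩
    have := (Finset.sum_eq_zero_iff.1 hs) o (Finset.mem_univ _)
    simpa using this
  | succ n ih =>
    intro σ hs hσ o
    rcases h : σ o with _ | ⟨e, es⟩
    · exact ⟨o, [], σ, rfl, h, by simp⟩
    have heo : G.src e = o := hσ o e (by simp [h])
    obtain ⟨z, P, σ', h1, h2, h3⟩ := ih (Function.update σ o es) (by
      have a := Finset.add_sum_erase Finset.univ (fun v => (σ v).length) (Finset.mem_univ o)
      have b := Finset.add_sum_erase Finset.univ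
        (fun v => (Function.update σ o es v).length) (Finset.mem_univ o)
      have c : ∑ v ∈ Finset.univ.erase o, (Function.update σ o es v).length =
          ∑ v ∈ Finset.univ.erase o, (σ v).length := by
        apply Finset.sum_congr rfl
        intro v hv
        rw [Function.update_of_ne (Finset.ne_of_mem_erase hv)]
      simp only [Function.update_self, h, List.length_cons] at a b
      omega) (by
      intro v f hf
      by_cases hv : v = o
      · subst hv
        rw [Function.update_self] at hf
        exact hσ v f (by simp [h, hf])
      · rw [Function.update_of_ne hv] at hf
        exact hσ v f hf) (G.dst e)
    refine ⟨z, e :: P, σ', ⟨heo, h1⟩, h2, ?_⟩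
    intro v
    have := h3 v
    by_cases hv : v = o
    · subst hv
      rw [Function.update_self] at this
      simp [List.filter_cons, heo, h, this]
    · rw [Function.update_of_ne hv] at this
      have : ¬ o = v := fun h => hv h.symm
      simp [List.filter_cons, heo, this, *]

theorem b_inj {V E : Type} [DecidableEq V] (G : DigraphStruct V E) (z : V) :
    ∀ (P Q : List E) (o : V), IsPathList G o z P → IsPathList G o z Q →
      (∀ v, (P.filter fun e => decide (G.src e = v)) = Q.filter fun e => decide (G.src e = v)) →
      P = Q := by
  intro P
  induction P with
  | nil =>
    intro Q o _ _ h
    rcases Q with _ | ⟨f, fs⟩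
    · rfl
    · have := h (G.src f); simp at this
  | cons e es ih =>
    intro Q o hP hQ h
    rcases Q with _ | ⟨f, fs⟩
    · have := h (G.src e); simp at this
    obtain ⟨a1, a2⟩ := hP
    obtain ⟨b1, b2⟩ := hQ
    have h0 := h o
    simp only [List.filter_cons, a1, b1, decide_true, if_true, List.cons.injEq] at h0
    obtain ⟨rfl, h0⟩ := h0
    congr 1
    apply ih fs _ a2 b2
    intro v
    have := h v
    simp only [List.filter_cons] at this
    split_ifs at this
    · simpa using this
    · exact this

theorem b_outDeg {V E : Type} [Fintype E] [DecidableEq V] (G : DigraphStruct V E) (v : V) :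
    G.outDeg v = (Finset.univ.filter fun e => G.src e = v).card := by
  rw [DigraphStruct.outDeg, ← Set.ncard_coe_finset]; congr; ext; simp [DigraphStruct.outEdges]

theorem b_inDeg {V E : Type} [Fintype E] [DecidableEq V] (G : DigraphStruct V E) (v : V) :
    G.inDeg v = (Finset.univ.filter fun e => G.dst e = v).card := by
  rw [DigraphStruct.inDeg, ← Set.ncard_coe_finset]; congr; ext; simp [DigraphStruct.inEdges]

theorem b_bal {V E : Type} [DecidableEq V] (G : DigraphStruct V E) (o z : V)
    (hG : IsFinEulerian G o z) (v : V) :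
    G.outDeg v + (if v = z then 1 else 0) = G.inDeg v + (if v = o then 1 else 0) := by
  by_cases h : o = z
  · have := hG.bal_eq h v
    subst h; omega
  · obtain ⟨a, b, c⟩ := hG.bal_ne h
    by_cases h1 : v = o
    · subst h1; simp [h]; omega
    · by_cases h2 : v = z
      · subst h2; simp [h1]; omega
      · simp [h1, h2, a v h1 h2]

theorem b_outEdge {V E : Type} (G : DigraphStruct V E) (o z : V)
    (hG : IsFinEulerian G o z) (v : V) (hv : v ≠ z) : ∃ e, G.src e = v := by
  rcases Relation.ReflTransGen.cases_head (hG.reach_to v) with h | ⟨u, ⟨e, he, _⟩, _⟩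
  · exact absurd h hv
  · exact ⟨e, he⟩

theorem b_fwd {V E : Type} [DecidableEq V]
    (G : DigraphStruct V E) (o z : V) (hG : IsFinEulerian G o z) (St : V → List E)
    (hSt : BValid G St) (P : List E) (hP : IsEulerList G o z P)
    (hPS : ∀ v : V, St v = P.filter fun e => decide (G.src e = v)) :
    IsFinArb G z (bBot z St) := by
  have hsrc : ∀ v e, (St v).getLast? = some e → G.src e = v := fun v e h =>
    ((hSt v).2 e).1 (List.mem_of_getLast? h)
  refine ⟨?_, ?_, ?_⟩
  · rintro e ⟨v, hv, he⟩
    rw [hsrc v e he]; exact hv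
  · intro v hv
    obtain ⟨e, he⟩ := b_outEdge G o z hG v hv
    have hne : St v ≠ [] := List.ne_nil_of_mem (((hSt v).2 e).2 he)
    have hl := List.getLast?_eq_getLast_of_ne_nil hne
    refine ⟨_, ⟨⟨v, hv, hl⟩, hsrc _ _ hl⟩, ?_⟩
    rintro f ⟨⟨w, hw, hf⟩, hfv⟩
    have := hsrc _ _ hf
    have : w = v := by rw [← this, hfv]
    subst this
    rw [hl] at hf; exact (Option.some.inj hf).symm
  · intro v
    by_cases hv : v = z
    · subst hv; exact .refl
    apply b_reach G z _ P o hP.1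
    · intro w e hw he
      exact ⟨w, hw, by rw [hPS]; exact he⟩
    · right
      obtain ⟨e, he⟩ := b_outEdge G o z hG v hv
      exact ⟨e, hP.2.2 e, he⟩

theorem b_bwd {V E : Type} [Fintype V] [Fintype E] [DecidableEq V] [DecidableEq E]
    (G : DigraphStruct V E) (o z : V) (hG : IsFinEulerian G o z) (St : V → List E)
    (hSt : BValid G St) (hA : IsFinArb G z (bBot z St)) :
    ∃ P : List E, IsEulerList G o z P ∧
      ∀ v : V, St v = P.filter fun e => decide (G.src e = v) := by
  obtain ⟨z', P, σ', hP, hz', hσ⟩ := b_run G _ St rfl (fun v e he => ((hSt v).2 e).1 he) o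
  have hnd : P.Nodup := by
    rw [List.nodup_iff_count_le_one]
    intro e
    have h1 : (P.filter fun f => decide (G.src f = G.src e)).Nodup := by
      have := (hSt (G.src e)).1
      rw [hσ] at this
      exact (List.nodup_append.1 this).1
    have h2 := List.nodup_iff_count_le_one.1 h1 e
    rwa [List.count_filter (by simp)] at h2
  have hin : ∀ v, (P.filter fun e => decide (G.dst e = v)).length =
      (P.toFinset.filter fun e => G.dst e = v).card := by
    intro v
    rw [← List.toFinset_card_of_nodup (hnd.filter _)]
    congr 1; ext; simp
  have hinle : ∀ v, (P.filter fun e => decide (G.dst e = v)).length ≤ G.inDeg v := by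
    intro v
    rw [hin, b_inDeg]
    exact Finset.card_le_card (Finset.filter_subset_filter _ (Finset.subset_univ _))
  have hout : ∀ v, (St v).length = G.outDeg v := by
    intro v
    rw [b_outDeg, ← List.toFinset_card_of_nodup (hSt v).1]
    congr 1; ext e; simp [(hSt v).2 e]
  have hzz : z' = z := by
    have h1 := b_balance G z' z' P o hP
    have h2 := b_bal G o z hG z'
    have h3 := hinle z'
    have h4 := hout z'
    rw [hσ, hz', List.append_nil] at h4
    by_contra hne
    simp only [if_neg hne, if_true] at h1 h2
    omega
  subst hzz
  have hall : ∀ v, σ' v = [] := by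
    intro v
    induction hA.2.2 v using Relation.ReflTransGen.head_induction_on with
    | refl => exact hz'
    | head hs _ ih =>
      rename_i a c _
      obtain ⟨e, ⟨w, hw, hl⟩, hea, hec⟩ := hs
      have hwa : w = a := by
        rw [← hea]; exact (((hSt w).2 e).1 (List.mem_of_getLast? hl)).symm
      subst hwa
      have heP : e ∈ P := by
        have h1 := b_balance G z' c P o hP
        have h2 := b_bal G o z' hG c
        have h4 := hout c
        rw [hσ, ih, List.append_nil] at h4
        have h5 : (P.filter fun e => decide (G.dst e = c)).length = G.inDeg c := by omega
        rw [hin, b_inDeg] at h5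
        have h6 := Finset.eq_of_subset_of_card_le
          (Finset.filter_subset_filter (fun e => G.dst e = c) (Finset.subset_univ P.toFinset))
          h5.ge
        have : e ∈ Finset.univ.filter (fun e => G.dst e = c) := by simp [hec]
        rw [← h6] at this
        simpa using (Finset.mem_filter.1 this).1
      by_contra hne
      have hn := (hSt w).1
      rw [hσ] at hn hl
      rw [List.getLast?_append_of_ne_nil _ hne] at hl
      have hd := (List.nodup_append.1 hn).2.2
      exact hd e (by simp [heP, hea]) e (List.mem_of_getLast? hl) rfl
  have hPS : ∀ v : V, St v = P.filter fun e => decide (G.src e = v) := by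
    intro v; have h := hσ v; rwa [hall v, List.append_nil] at h
  refine ⟨P, ⟨hP, hnd, ?_⟩, hPS⟩
  intro e
  have := ((hSt (G.src e)).2 e).2 rfl
  rw [hPS] at this
  exact (List.mem_filter.1 this).1

theorem b_iff {V E : Type} [Fintype V] [Fintype E] [DecidableEq V] [DecidableEq E]
    (G : DigraphStruct V E) (o z : V) (hG : IsFinEulerian G o z) (St : V → List E)
    (hSt : BValid G St) : 
    (∃ P : List E, IsEulerList G o z P ∧
      ∀ v : V, St v = P.filter fun e => decide (G.src e = v)) ↔ IsFinArb G z (bBot z St) :=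
  ⟨fun ⟨P, h1, h2⟩ => b_fwd G o z hG St hSt P h1 h2, b_bwd G o z hG St hSt⟩

theorem b_lists {E : Type} [DecidableEq E] (s : Finset E) :
    Nat.card {l : List E // l.Nodup ∧ ∀ e, e ∈ l ↔ e ∈ s} = s.card.factorial := by
  have h : ∀ l : List E, l ∈ s.toList.permutations.toFinset ↔ (l.Nodup ∧ ∀ e, e ∈ l ↔ e ∈ s) := by
    intro l
    rw [List.mem_toFinset, List.mem_permutations]
    constructor
    · intro h
      exact ⟨h.nodup_iff.2 s.nodup_toList, fun e => by rw [h.mem_iff, Finset.mem_toList]⟩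
    · rintro ⟨h1, h2⟩
      rw [List.perm_ext_iff_of_nodup h1 s.nodup_toList]
      intro e; rw [h2, Finset.mem_toList]
  rw [← Nat.card_congr (Equiv.subtypeEquivRight h), Nat.card_eq_fintype_card, Fintype.card_coe,
    List.toFinset_card_of_nodup (List.nodup_permutations _ s.nodup_toList),
    List.length_permutations, Finset.length_toList]

theorem b_listsLast {E : Type} [DecidableEq E] (s : Finset E) (b : E) (hb : b ∈ s) :
    Nat.card {l : List E // (l.Nodup ∧ ∀ e, e ∈ l ↔ e ∈ s) ∧ l.getLast? = some b} =
      (s.card - 1).factorial := by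
  rw [← Finset.card_erase_of_mem hb, ← b_lists]
  symm
  apply Nat.card_congr
  refine Equiv.ofBijective (fun l => ⟨l.1 ++ [b], ?_⟩) ⟨?_, ?_⟩
  · obtain ⟨l, h1, h2⟩ := l
    refine ⟨⟨?_, ?_⟩, by simp⟩
    · rw [List.nodup_append]
      refine ⟨h1, by simp, ?_⟩
      intro a ha c hc
      have := (h2 a).1 ha
      simp at hc; subst hc
      exact Finset.ne_of_mem_erase this
    · intro e
      simp [h2]
      by_cases h : e = b
      · subst h; simp [hb]
      · simp [h]
  · rintro ⟨l, hl⟩ ⟨m, hm⟩ h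
    simpa using h
  · rintro ⟨l, ⟨h1, h2⟩, h3⟩
    obtain ⟨m, rfl⟩ := List.getLast?_eq_some_iff.1 h3
    rw [List.nodup_append] at h1
    refine ⟨⟨m, h1.1, ?_⟩, rfl⟩
    intro e
    rw [Finset.mem_erase, ← h2]
    constructor
    · intro he
      exact ⟨h1.2.2 e he b (by simp), by simp [he]⟩
    · rintro ⟨a, c⟩
      simpa [a] using c

theorem b_fiber {V E : Type} [Fintype V] [Fintype E] [DecidableEq V] [DecidableEq E]
    (G : DigraphStruct V E) (z : V) (B : Set E) (hB : IsFinArb G z B) :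
    Nat.card {St : V → List E // BValid G St ∧ bBot z St = B} =
      (G.outDeg z).factorial * ∏ v ∈ Finset.univ.erase z, (G.outDeg v - 1).factorial := by
  have hiff : ∀ St : V → List E, (BValid G St ∧ bBot z St = B) ↔
      ∀ v, ((St v).Nodup ∧ ∀ e, e ∈ St v ↔ e ∈ Finset.univ.filter (fun e => G.src e = v)) ∧
        (v ≠ z → ∃ e ∈ B, (St v).getLast? = some e) := by
    intro St
    simp only [Finset.mem_filter, Finset.mem_univ, true_and, forall_and, BValid]
    refine and_congr_right ?_
    rintro ⟨h1, h2⟩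
    have hsrc : ∀ v e, (St v).getLast? = some e → G.src e = v := fun v e h =>
      (h2 v e).1 (List.mem_of_getLast? h)
    constructor
    · rintro rfl v hv
      obtain ⟨e, ⟨he, hev⟩, -⟩ := hB.2.1 v hv
      refine ⟨e, he, ?_⟩
      obtain ⟨w, hw, hl⟩ := he
      have := hsrc _ _ hl
      rw [← hev, this]; exact hl
    · intro h
      ext e
      constructor
      · rintro ⟨v, hv, hl⟩
        obtain ⟨f, hf, hf'⟩ := h v hv
        rw [hl] at hf'
        rw [Option.some.inj hf']; exact hf
      · intro he
        have hez := hB.1 e he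
        obtain ⟨f, hf, hl⟩ := h _ hez
        refine ⟨G.src e, hez, ?_⟩
        rw [hl, (hB.2.1 _ hez).unique ⟨he, rfl⟩ ⟨hf, hsrc _ _ hl⟩]
  rw [Nat.card_congr (Equiv.subtypeEquivRight hiff), Nat.card_congr (Equiv.subtypePiEquivPi (p := fun v (l : List E) =>
      (l.Nodup ∧ ∀ e, e ∈ l ↔ e ∈ Finset.univ.filter (fun e => G.src e = v)) ∧
        (v ≠ z → ∃ e ∈ B, l.getLast? = some e))),
    Nat.card_pi, ← Finset.mul_prod_erase _ _ (Finset.mem_univ z)]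
  congr 1
  · rw [b_outDeg, ← b_lists]
    apply Nat.card_congr
    apply Equiv.subtypeEquivRight
    intro l; simp
  · apply Finset.prod_congr rfl
    intro v hv
    have hv := Finset.ne_of_mem_erase hv
    obtain ⟨b, ⟨hb, hbv⟩, hu⟩ := hB.2.1 v hv
    rw [b_outDeg, ← b_listsLast _ b (by simp [hbv])]
    apply Nat.card_congr
    apply Equiv.subtypeEquivRight
    intro l
    refine and_congr_right ?_
    rintro ⟨h1, h2⟩
    constructor
    · intro h
      obtain ⟨e, he, hl⟩ := h hv
      have := (h2 e).1 (List.mem_of_getLast? hl)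
      rw [hl, hu e ⟨he, by simpa using this⟩]
    · intro h _
      exact ⟨b, hb, h⟩

theorem b_count {V E : Type} [Fintype V] [Fintype E] [DecidableEq V] [DecidableEq E]
    (G : DigraphStruct V E) (o z : V) (hG : IsFinEulerian G o z) :
    Nat.card {P : List E // IsEulerList G o z P} =
      Nat.card {B : Set E // IsFinArb G z B} * ((G.outDeg z).factorial *
        ∏ v ∈ Finset.univ.erase z, (G.outDeg v - 1).factorial) := by
  classical
  have hval : ∀ P, IsEulerList G o z P →
      BValid G (fun v => P.filter fun e => decide (G.src e = v)) := by
    intro P hP v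
    exact ⟨hP.2.1.filter _, fun e => by simp [hP.2.2 e]⟩
  have e1 : {P : List E // IsEulerList G o z P} ≃
      {St : V → List E // BValid G St ∧ IsFinArb G z (bBot z St)} := by
    refine Equiv.ofBijective (fun P => ⟨fun v => P.1.filter fun e => decide (G.src e = v),
      hval P.1 P.2, (b_iff G o z hG _ (hval P.1 P.2)).1 ⟨P.1, P.2, fun _ => rfl⟩⟩) ⟨?_, ?_⟩
    · rintro ⟨P, hP⟩ ⟨Q, hQ⟩ h
      have h' := congrArg Subtype.val h
      exact Subtype.ext (b_inj G z P Q o hP.1 hQ.1 fun v => congrFun h' v)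
    · rintro ⟨St, h1, h2⟩
      obtain ⟨P, hP, hPS⟩ := (b_iff G o z hG St h1).2 h2
      exact ⟨⟨P, hP⟩, Subtype.ext (funext fun v => (hPS v).symm)⟩
  have e2 : {St : V → List E // BValid G St ∧ IsFinArb G z (bBot z St)} ≃
      Σ B : {B : Set E // IsFinArb G z B}, {St : V → List E // BValid G St ∧ bBot z St = B.1} :=
    { toFun := fun St => ⟨⟨bBot z St.1, St.2.2⟩, ⟨St.1, St.2.1, rfl⟩⟩
      invFun := fun x => ⟨x.2.1, x.2.2.1, by rw [x.2.2.2]; exact x.1.2⟩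
      left_inv := fun _ => rfl
      right_inv := by
        rintro ⟨⟨B, hB⟩, ⟨St, h1, h2⟩⟩
        dsimp only at h2
        subst h2
        rfl }
  have hf : ∀ B : {B : Set E // IsFinArb G z B},
      Finite {St : V → List E // BValid G St ∧ bBot z St = B.1} := by
    intro B
    apply Nat.finite_of_card_ne_zero
    rw [b_fiber G z B.1 B.2]
    refine Nat.mul_ne_zero (Nat.factorial_ne_zero _) ?_
    exact Finset.prod_ne_zero_iff.2 fun _ _ => Nat.factorial_ne_zero _
  letI : Fintype {B : Set E // IsFinArb G z B} := Fintype.ofFinite _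
  rw [Nat.card_congr (e1.trans e2), Nat.card_sigma,
    Finset.sum_congr rfl (fun B _ => b_fiber G z B.1 B.2), Finset.sum_const, Finset.card_univ,
    ← Nat.card_eq_fintype_card, smul_eq_mul]

end BestHelpers

/-- **BEST theorem.** In a finite Eulerian digraph with source `o` and sink `z`,
a stack configuration listing each outgoing edge exactly once represents an Eulerian path from
`o` to `z` if and only if the bottom edges of the stacks away from `z` form a spanning
in-arborescence rooted at `z`; consequently the number of Eulerian paths from `o` to `z` is
`|𝒜ᶻ| ⬝ outdeg(z)! ⬝ ∏_{v ≠ z} (outdeg(v) - 1)!`. -/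
theorem stmt9 {V E : Type} [Fintype V] [Fintype E] [DecidableEq V] [DecidableEq E]
    (G : DigraphStruct V E) (o z : V) (hG : IsFinEulerian G o z) :
    (∀ St : V → List E, (∀ v : V, (St v).Nodup ∧ ∀ e : E, e ∈ St v ↔ G.src e = v) →
      ((∃ P : List E, IsEulerList G o z P ∧
          ∀ v : V, St v = P.filter fun e => decide (G.src e = v)) ↔
        IsFinArb G z {e : E | ∃ v : V, v ≠ z ∧ (St v).getLast? = some e})) ∧
    Nat.card {P : List E // IsEulerList G o z P} =
      Nat.card {B : Set E // IsFinArb G z B} * (G.outDeg z).factorial *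
        ∏ v ∈ Finset.univ.erase z, (G.outDeg v - 1).factorial := by
  refine ⟨fun St hSt => b_iff G o z hG St hSt, ?_⟩
  rw [b_count G o z hG, mul_assoc]

end DF
end
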